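/- R1 + EPR cannot polynomially simulate tree R1 + Sk: there is no polynomial q such that for every false closed PCNF Φ, whenever Sk(Φ) ∪ {p(f₁), ¬p(f₀)} has a tree R1 refutation of size s, EPR(Φ) ∪ {p(f₁), ¬p(f₀)} has an R1 refutation of size at most q(s). -/

import Mathlib

/-! ## Propositional / QBF side -/

inductive Lit where
  | pos (x : ℕ)
  | neg (x : ℕ)
deriving DecidableEq

def Lit.var : Lit → ℕ
  | pos x => x
  | neg x => x

def Lit.isPos : Lit → Bool
  | pos _ => true
  | neg _ => false

def Lit.negate : Lit → Lit
  | pos x => neg x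
  | neg x => pos x

def Lit.eval (v : ℕ → Bool) : Lit → Bool
  | pos x => v x
  | neg x => !(v x)

abbrev Clause := Finset Lit

def Clause.Taut (C : Clause) : Prop := ∃ x, Lit.pos x ∈ C ∧ Lit.neg x ∈ C

/-- A prenex CNF: a list of quantifier blocks (`true` = existential,
`false` = universal), each with an ordered list of variables, and a matrix
which is a finite set of clauses. -/
structure PCNF where
  blocks : List (Bool × List ℕ)
  matrix : Finset Clause

def PCNF.allVars (Φ : PCNF) : List ℕ := Φ.blocks.flatMap (·.2)

/-- Well-formedness: quantifier blocks alternate and the blocks are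
pairwise disjoint sets of variables (no repetitions). -/
def PCNF.WF (Φ : PCNF) : Prop :=
  List.Chain' (fun a b => a.1 ≠ b.1) Φ.blocks ∧ Φ.allVars.Nodup ∧
    ∀ b ∈ Φ.blocks, b.2 ≠ []

/-- Closedness: every variable of the matrix is quantified in the prefix. -/
def PCNF.Closed (Φ : PCNF) : Prop :=
  ∀ C ∈ Φ.matrix, ∀ l ∈ C, l.var ∈ Φ.allVars

def PCNF.existB (Φ : PCNF) (x : ℕ) : Bool :=
  Φ.blocks.any fun b => b.1 && b.2.contains x

def PCNF.univB (Φ : PCNF) (x : ℕ) : Bool :=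
  Φ.blocks.any fun b => !b.1 && b.2.contains x

/-- The level of a variable: the index of its quantifier block. -/
def PCNF.lv (Φ : PCNF) (x : ℕ) : ℕ :=
  Φ.blocks.findIdx fun b => b.2.contains x

def evalClause (v : ℕ → Bool) (C : Clause) : Prop := ∃ l ∈ C, l.eval v = true

/-- Standard QBF semantics of a prenex CNF, evaluated block by block. -/
def truthAux (M : Finset Clause) : List (Bool × List ℕ) → (ℕ → Bool) → Prop
  | [], v => ∀ C ∈ M, evalClause v C
  | (q, xs) :: rest, v =>
      if q then ∃ w : ℕ → Bool, (∀ y, y ∉ xs → w y = v y) ∧ truthAux M rest w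
      else ∀ w : ℕ → Bool, (∀ y, y ∉ xs → w y = v y) → truthAux M rest w

def PCNF.IsTrue (Φ : PCNF) : Prop := truthAux Φ.matrix Φ.blocks fun _ => false

/-! ## Q-resolution and QU-resolution -/

/-- One derivation step of Q-res (`univPivot = false`) resp. QU-res
(`univPivot = true`) from the clauses derived so far. -/
inductive QStep (Φ : PCNF) (univPivot : Bool) (prev : List Clause) : Clause → Prop
  | ax (C : Clause) (hC : C ∈ Φ.matrix) (hnt : ¬ C.Taut) : QStep Φ univPivot prev C
  | res (x : ℕ) (A B : Clause) (hA : A ∈ prev) (hB : B ∈ prev)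
      (hxa : Lit.pos x ∈ A) (hxb : Lit.neg x ∈ B)
      (hpiv : Φ.existB x = true ∨ (univPivot = true ∧ Φ.univB x = true))
      (hblock : ∀ l ∈ A.erase (Lit.pos x), l.negate ∉ B.erase (Lit.neg x)) :
      QStep Φ univPivot prev ((A.erase (Lit.pos x)) ∪ (B.erase (Lit.neg x)))
  | fac (A : Clause) (hA : A ∈ prev) : QStep Φ univPivot prev A
  | univRed (A : Clause) (m : Lit) (hA : A ∈ prev) (hm : m ∈ A)
      (hu : Φ.univB m.var = true)
      (hlv : ∀ l ∈ A.erase m, Φ.existB l.var = true → Φ.lv l.var < Φ.lv m.var) :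
      QStep Φ univPivot prev (A.erase m)

def QValid (Φ : PCNF) (univPivot : Bool) (π : List Clause) : Prop :=
  ∀ i < π.length, QStep Φ univPivot (π.take i) π[i]!

def QRefutation (Φ : PCNF) (univPivot : Bool) (π : List Clause) : Prop :=
  QValid Φ univPivot π ∧ π ≠ [] ∧ π.getLast! = (∅ : Clause)

/-- Size of a (QBF) resolution derivation: total number of literal
occurrences in its clauses. -/
def qSize (π : List Clause) : ℕ := (π.map Finset.card).sum

/-! ## First-order terms, atoms, literals, clauses -/

inductive FTerm where
  | var (x : ℕ)
  | app (f : ℕ) (args : List FTerm)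

noncomputable instance : DecidableEq FTerm := Classical.decEq _

def FTerm.subst (σ : ℕ → FTerm) : FTerm → FTerm
  | .var x => σ x
  | .app f args => .app f (args.attach.map fun t => t.1.subst σ)
decreasing_by
  have := List.sizeOf_lt_of_mem t.2
  simp only [FTerm.app.sizeOf_spec]; omega

def FTerm.symSize : FTerm → ℕ
  | .var _ => 1
  | .app _ args => 1 + (args.attach.map fun t => t.1.symSize).sum
decreasing_by
  have := List.sizeOf_lt_of_mem t.2
  simp only [FTerm.app.sizeOf_spec]; omega

def FTerm.vars : FTerm → Finset ℕ
  | .var x => {x}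
  | .app _ args => (args.attach.map fun t => t.1.vars).foldr (· ∪ ·) ∅
decreasing_by
  have := List.sizeOf_lt_of_mem t.2
  simp only [FTerm.app.sizeOf_spec]; omega

/-- An atom `p(t₁,…,t_k)`: predicate symbol together with argument list. -/
structure FAtom where
  p : ℕ
  args : List FTerm

noncomputable instance : DecidableEq FAtom := Classical.decEq _

def FAtom.subst (σ : ℕ → FTerm) (a : FAtom) : FAtom := ⟨a.p, a.args.map (FTerm.subst σ)⟩
def FAtom.symSize (a : FAtom) : ℕ := 1 + (a.args.map FTerm.symSize).sum
def FAtom.vars (a : FAtom) : Finset ℕ := (a.args.map FTerm.vars).foldr (· ∪ ·) ∅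

inductive FLit where
  | pos (a : FAtom)
  | neg (a : FAtom)

noncomputable instance : DecidableEq FLit := Classical.decEq _

def FLit.atom : FLit → FAtom
  | pos a => a
  | neg a => a

def FLit.isPos : FLit → Bool
  | pos _ => true
  | neg _ => false

def FLit.subst (σ : ℕ → FTerm) : FLit → FLit
  | pos a => pos (a.subst σ)
  | neg a => neg (a.subst σ)

def FLit.symSize (l : FLit) : ℕ :=
  match l with
  | .pos a => a.symSize
  | .neg a => 1 + a.symSize

abbrev FClause := Finset FLit

noncomputable def FClause.subst (σ : ℕ → FTerm) (C : FClause) : FClause :=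
  C.image (FLit.subst σ)

noncomputable def FClause.symSize (C : FClause) : ℕ := ∑ l ∈ C, l.symSize

noncomputable def FClause.fvars (C : FClause) : Finset ℕ := C.sup fun l => l.atom.vars

/-! ## First-order resolution R1 -/

def compSub (σ μ : ℕ → FTerm) : ℕ → FTerm := fun x => (σ x).subst μ

def Unifies (σ : ℕ → FTerm) (a b : FAtom) : Prop := a.subst σ = b.subst σ

def IsMGU (σ : ℕ → FTerm) (a b : FAtom) : Prop :=
  Unifies σ a b ∧ ∀ τ, Unifies τ a b → ∃ μ, ∀ x, compSub σ μ x = τ x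

/-- `D` is a factor of `C`: `D = Cσ` for `σ` an mgu of two distinct
same-sign literals of `C`. -/
def IsFactor (C D : FClause) : Prop :=
  ∃ K L σ, K ∈ C ∧ L ∈ C ∧ K ≠ L ∧ K.isPos = L.isPos ∧
    IsMGU σ K.atom L.atom ∧ D = C.subst σ

def renameSub (ρ : ℕ → ℕ) : ℕ → FTerm := fun x => .var (ρ x)

/-- `E` is a resolvent of `C` and `D`. -/
def IsResolvent (C D E : FClause) : Prop :=
  ∃ ρ : ℕ → ℕ, Function.Injective ρ ∧
    ∃ K L σ, Disjoint C.fvars (FClause.subst (renameSub ρ) D).fvars ∧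
      K ∈ C ∧ L ∈ FClause.subst (renameSub ρ) D ∧ K.isPos = !L.isPos ∧
      IsMGU σ K.atom L.atom ∧
      E = ((C.subst σ).erase (K.subst σ)) ∪
          (((FClause.subst (renameSub ρ) D).subst σ).erase (L.subst σ))

def R1Valid (S : Set FClause) (π : List FClause) : Prop :=
  ∀ i < π.length,
    π[i]! ∈ S ∨ (∃ j < i, IsFactor π[j]! π[i]!) ∨
      (∃ j < i, ∃ k < i, IsResolvent π[j]! π[k]! π[i]!)

def R1Refutation (S : Set FClause) (π : List FClause) : Prop :=
  R1Valid S π ∧ π ≠ [] ∧ π.getLast! = (∅ : FClause)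

noncomputable def r1Size (π : List FClause) : ℕ := (π.map FClause.symSize).sum

/-- Tree-form R1 refutations: every clause occurrence is used at most once
as a premise, which is inherent in a tree-structured derivation. -/
inductive R1Tree (S : Set FClause) : FClause → Type
  | input (C : FClause) (h : C ∈ S) : R1Tree S C
  | factor {C : FClause} (t : R1Tree S C) (D : FClause) (h : IsFactor C D) : R1Tree S D
  | resolve {C D : FClause} (t₁ : R1Tree S C) (t₂ : R1Tree S D) (E : FClause)
      (h : IsResolvent C D E) : R1Tree S E

noncomputable def R1Tree.size {S : Set FClause} : {C : FClause} → R1Tree S C → ℕ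
  | C, .input _ _ => C.symSize
  | D, .factor t _ _ => t.size + D.symSize
  | E, .resolve t₁ t₂ _ _ => t₁.size + t₂.size + E.symSize

def R1Tree.clauseCount {S : Set FClause} : {C : FClause} → R1Tree S C → ℕ
  | _, .input _ _ => 1
  | _, .factor t _ _ => t.clauseCount + 1
  | _, .resolve t₁ t₂ _ _ => t₁.clauseCount + t₂.clauseCount + 1

/-! ## The Skolem and EPR translations -/

/-- The universal variables strictly preceding `a` in the prefix,
in prefix order. -/
def PCNF.univBefore (Φ : PCNF) (a : ℕ) : List ℕ :=
  ((Φ.blocks.flatMap fun b => b.2.map fun x => (b.1, x)).takeWhile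
      fun p => p.2 ≠ a).filterMap
    fun p => if p.1 = false then some p.2 else none

/-- `p` is the predicate symbol `0`; `f₀`, `f₁` are the constants `0`, `1`;
the Skolem function symbol for existential variable `a` is `a + 2`. -/
def skAtom (Φ : PCNF) (x : ℕ) : FAtom :=
  if Φ.existB x then ⟨0, [FTerm.app (x + 2) ((Φ.univBefore x).map FTerm.var)]⟩
  else ⟨0, [FTerm.var x]⟩

def skLit (Φ : PCNF) : Lit → FLit
  | .pos x => .pos (skAtom Φ x)
  | .neg x => .neg (skAtom Φ x)

noncomputable def skClause (Φ : PCNF) (C : Clause) : FClause := C.image (skLit Φ)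

def pf1Cl : FClause := {FLit.pos ⟨0, [FTerm.app 1 []]⟩}
def npf0Cl : FClause := {FLit.neg ⟨0, [FTerm.app 0 []]⟩}

/-- The clause set `Sk(Φ) ∪ {p(f₁), ¬p(f₀)}`. -/
noncomputable def skSet (Φ : PCNF) : Set FClause :=
  ↑(Φ.matrix.image (skClause Φ)) ∪ {pf1Cl, npf0Cl}

/-- EPR atom: `p(f_a(u₁,…,u_k))` with `k ≥ 1` becomes `p_a(u₁,…,u_k)`,
where the fresh predicate symbol `p_a` is `a + 1`. -/
def eprAtom (Φ : PCNF) (x : ℕ) : FAtom :=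
  if Φ.existB x then
    if Φ.univBefore x = [] then ⟨0, [FTerm.app (x + 2) []]⟩
    else ⟨x + 1, (Φ.univBefore x).map FTerm.var⟩
  else ⟨0, [FTerm.var x]⟩

def eprLit (Φ : PCNF) : Lit → FLit
  | .pos x => .pos (eprAtom Φ x)
  | .neg x => .neg (eprAtom Φ x)

noncomputable def eprClause (Φ : PCNF) (C : Clause) : FClause := C.image (eprLit Φ)

/-- The clause set `EPR(Φ) ∪ {p(f₁), ¬p(f₀)}`. -/
noncomputable def eprSet (Φ : PCNF) : Set FClause :=
  ↑(Φ.matrix.image (eprClause Φ)) ∪ {pf1Cl, npf0Cl}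

/-! ## IR-calc and its extensions -/

/-- An annotation: a (functional) finite set of assignments
`universal variable ↦ 0/1` (`false` = 0, `true` = 1). -/
abbrev Ann := Finset (ℕ × Bool)

def Ann.Functional (τ : Ann) : Prop := ∀ x b b', (x, b) ∈ τ → (x, b') ∈ τ → b = b'

/-- Restriction `[σ]` of an annotation to the universal variables of level
below the level of the literal `l`. -/
def annRestr (Φ : PCNF) (σ : Ann) (l : Lit) : Ann :=
  σ.filter fun p => Φ.lv p.1 < Φ.lv l.var

/-- Completion of `μ` by `τ`. -/
def annCompl (μ τ : Ann) : Ann :=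
  μ ∪ τ.filter fun p => p.1 ∉ μ.image Prod.fst

structure ALit where
  lit : Lit
  ann : Ann
deriving DecidableEq

abbrev AClause := Finset ALit

def ALit.symSize (al : ALit) : ℕ := 1 + 2 * al.ann.card
def AClause.symSize (A : AClause) : ℕ := ∑ al ∈ A, al.symSize
def aSize (π : List AClause) : ℕ := (π.map AClause.symSize).sum

/-- The annotation extracted from the universal literals of a clause:
`u ↦ 0` for positive and `u ↦ 1` for negative universal literals. -/
def axAnn (Φ : PCNF) (C : Clause) : Ann :=
  (C.filter fun l => Φ.univB l.var).image fun l =>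
    match l with
    | .pos u => (u, false)
    | .neg u => (u, true)

/-- The axiom clause of IR-calc obtained from a matrix clause. -/
def axClause (Φ : PCNF) (C : Clause) : AClause :=
  (C.filter fun l => Φ.existB l.var).image fun l => ⟨l, annRestr Φ (axAnn Φ C) l⟩

/-- Application of a variable substitution `σ_v` (universal ↦ existential)
to a literal. -/
def applySigv (σv : ℕ → Option ℕ) : Lit → Lit
  | .pos x => match σv x with | some e => .pos e | none => .pos x
  | .neg x => match σv x with | some e => .neg e | none => .neg x

def Clause.applySigv (σv : ℕ → Option ℕ) (C : Clause) : Clause :=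
  C.image (_root_.applySigv σv)

/-- Admissibility of `σ_v`: it maps universal variables to existential
variables of strictly smaller level. -/
def Admissible (Φ : PCNF) (σv : ℕ → Option ℕ) : Prop :=
  ∀ x e, σv x = some e → Φ.univB x = true ∧ Φ.existB e = true ∧ Φ.lv e < Φ.lv x

/-- One step of IR-calc(P, M, Δ, σ_v).  Plain IR-calc is the instance with
`Δ = ∅` and `σv = fun _ => none`; IR-calc^{σ_v} the instance with `Δ = ∅`. -/
inductive IRStep (Φ : PCNF) (Δ : Finset Clause) (σv : ℕ → Option ℕ)
    (prev : List AClause) : AClause → Prop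
  | ax (C : Clause) (hC : C ∈ Φ.matrix) (hnt : ¬ C.Taut)
      (hnt' : ¬ (C.applySigv σv).Taut) :
      IRStep Φ Δ σv prev (axClause Φ (C.applySigv σv))
  | axExt (C : Clause) (hC : C ∈ Δ) (hnt : ¬ C.Taut) :
      IRStep Φ Δ σv prev (C.image fun l => ⟨l, ∅⟩)
  | res (x : ℕ) (τ : Ann) (A B : AClause) (hA : A ∈ prev) (hB : B ∈ prev)
      (hxa : (⟨Lit.pos x, τ⟩ : ALit) ∈ A) (hxb : (⟨Lit.neg x, τ⟩ : ALit) ∈ B) :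
      IRStep Φ Δ σv prev ((A.erase ⟨Lit.pos x, τ⟩) ∪ (B.erase ⟨Lit.neg x, τ⟩))
  | fac (A : AClause) (hA : A ∈ prev) : IRStep Φ Δ σv prev A
  | inst (A : AClause) (τ : Ann) (hA : A ∈ prev) (hfun : τ.Functional)
      (hdom : ∀ p ∈ τ, Φ.univB p.1 = true) :
      IRStep Φ Δ σv prev
        (A.image fun al => ⟨al.lit, annRestr Φ (annCompl al.ann τ) al.lit⟩)

def IRValid (Φ : PCNF) (Δ : Finset Clause) (σv : ℕ → Option ℕ)
    (π : List AClause) : Prop :=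
  ∀ i < π.length, IRStep Φ Δ σv (π.take i) π[i]!

def IRRefutation (Φ : PCNF) (Δ : Finset Clause) (σv : ℕ → Option ℕ)
    (π : List AClause) : Prop :=
  IRValid Φ Δ σv π ∧ π ≠ [] ∧ π.getLast! = (∅ : AClause)

def noSub : ℕ → Option ℕ := fun _ => none

/-- Tree-form IR-calc(P, M, Δ, σ_v) derivations. -/
inductive IRTree (Φ : PCNF) (Δ : Finset Clause) (σv : ℕ → Option ℕ) : AClause → Type
  | ax (C : Clause) (hC : C ∈ Φ.matrix) (hnt : ¬ C.Taut)
      (hnt' : ¬ (C.applySigv σv).Taut) : IRTree Φ Δ σv (axClause Φ (C.applySigv σv))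
  | axExt (C : Clause) (hC : C ∈ Δ) (hnt : ¬ C.Taut) :
      IRTree Φ Δ σv (C.image fun l => ⟨l, ∅⟩)
  | res {A B : AClause} (t₁ : IRTree Φ Δ σv A) (t₂ : IRTree Φ Δ σv B)
      (x : ℕ) (τ : Ann)
      (hxa : (⟨Lit.pos x, τ⟩ : ALit) ∈ A) (hxb : (⟨Lit.neg x, τ⟩ : ALit) ∈ B) :
      IRTree Φ Δ σv ((A.erase ⟨Lit.pos x, τ⟩) ∪ (B.erase ⟨Lit.neg x, τ⟩))
  | inst {A : AClause} (t : IRTree Φ Δ σv A) (τ : Ann) (hfun : τ.Functional)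
      (hdom : ∀ p ∈ τ, Φ.univB p.1 = true) :
      IRTree Φ Δ σv (A.image fun al => ⟨al.lit, annRestr Φ (annCompl al.ann τ) al.lit⟩)

def IRTree.size {Φ : PCNF} {Δ : Finset Clause} {σv : ℕ → Option ℕ} :
    {A : AClause} → IRTree Φ Δ σv A → ℕ
  | _, .ax C _ _ _ => AClause.symSize (axClause Φ (C.applySigv σv))
  | _, .axExt C _ _ => AClause.symSize (C.image fun l => (⟨l, ∅⟩ : ALit))
  | _, .res (A := A) (B := B) t₁ t₂ x τ _ _ =>
      t₁.size + t₂.size +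
        AClause.symSize ((A.erase ⟨Lit.pos x, τ⟩) ∪ (B.erase ⟨Lit.neg x, τ⟩))
  | _, .inst (A := A) t τ _ _ =>
      t.size + AClause.symSize (A.image fun al =>
        (⟨al.lit, annRestr Φ (annCompl al.ann τ) al.lit⟩ : ALit))


/-! ## The formula -/

def Lit.shift (s : ℕ) : Lit → Lit
  | .pos x => .pos (s + x)
  | .neg x => .neg (s + x)

theorem Lit.shift_var (s : ℕ) (l : Lit) : (l.shift s).var = s + l.var := by cases l <;> rfl
theorem Lit.negate_var (l : Lit) : l.negate.var = l.var := by cases l <;> rfl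

def bigClause (N m : ℕ) : Clause := (Finset.range m).image fun j => Lit.pos (2 * N + j)

def mkPhi (N m : ℕ) (cl : ℕ → Clause) : PCNF where
  blocks := [(false, List.range N), (true, List.range' N (N + m))]
  matrix := (Finset.range m).image (fun j => (cl j).image (Lit.shift N)) ∪ {bigClause N m} ∪
    (Finset.range m).biUnion fun j => (cl j).image fun l => {Lit.neg (2 * N + j), l.negate}

structure GoodCl (N m : ℕ) (cl : ℕ → Clause) : Prop where
  hN : 0 < N
  hm : 0 < m
  hne : ∀ j < m, (cl j).Nonempty
  hvar : ∀ j < m, ∀ l ∈ cl j, l.var < N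
  hinj : ∀ j < m, ∀ l ∈ cl j, ∀ l' ∈ cl j, l.var = l'.var → l = l'
  hunsat : ∀ v : ℕ → Bool, ∃ j < m, ∀ l ∈ cl j, l.eval v = false
  hfull : ∀ k < N, ∃ l ∈ cl 0, l.var = k

theorem mkPhi_allVars (N m : ℕ) (cl : ℕ → Clause) :
    (mkPhi N m cl).allVars = List.range (2 * N + m) := by
  simp only [PCNF.allVars, mkPhi, List.flatMap_cons, List.flatMap_nil, List.append_nil]
  rw [List.range_eq_range', List.range_eq_range']
  have h := List.range'_append_1 (s := 0) (m := N) (n := N + m)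
  rw [zero_add] at h
  rw [h]
  congr 1; omega

theorem mkPhi_wf {N m : ℕ} {cl : ℕ → Clause} (hN : 0 < N) :
    (mkPhi N m cl).WF := by
  refine ⟨?_, ?_, ?_⟩
  · simp [mkPhi, List.Chain']
  · rw [mkPhi_allVars]; exact List.nodup_range
  · intro b hb
    simp only [mkPhi, List.mem_cons, List.not_mem_nil, or_false] at hb
    rcases hb with rfl | rfl
    · simp; omega
    · simp; omega

theorem mkPhi_mem {N m : ℕ} {cl : ℕ → Clause} {C : Clause} :
    C ∈ (mkPhi N m cl).matrix ↔ (∃ j < m, C = (cl j).image (Lit.shift N)) ∨ C = bigClause N m ∨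
      ∃ j < m, ∃ l ∈ cl j, C = {Lit.neg (2 * N + j), l.negate} := by
  simp only [mkPhi, Finset.mem_union, Finset.mem_image, Finset.mem_range, Finset.mem_singleton,
    Finset.mem_biUnion]
  constructor
  · rintro ((⟨j, hj, rfl⟩ | rfl) | ⟨j, hj, l, hl, rfl⟩)
    · exact Or.inl ⟨j, hj, rfl⟩
    · exact Or.inr (Or.inl rfl)
    · exact Or.inr (Or.inr ⟨j, hj, l, hl, rfl⟩)
  · rintro (⟨j, hj, rfl⟩ | rfl | ⟨j, hj, l, hl, rfl⟩)
    · exact Or.inl (Or.inl ⟨j, hj, rfl⟩)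
    · exact Or.inl (Or.inr rfl)
    · exact Or.inr ⟨j, hj, l, hl, rfl⟩

theorem mkPhi_closed {N m : ℕ} {cl : ℕ → Clause} (h : GoodCl N m cl) :
    (mkPhi N m cl).Closed := by
  intro C hC l hl
  rw [mkPhi_allVars, List.mem_range]
  rcases mkPhi_mem.1 hC with ⟨j, hj, rfl⟩ | rfl | ⟨j, hj, l', hl', rfl⟩
  · obtain ⟨l', hl', rfl⟩ := Finset.mem_image.1 hl
    have := h.hvar j hj l' hl'
    rw [Lit.shift_var]; omega
  · obtain ⟨j, hj, rfl⟩ := Finset.mem_image.1 hl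
    simp at hj
    simp [Lit.var]; omega
  · have := h.hvar j hj l' hl'
    simp only [Finset.mem_insert, Finset.mem_singleton] at hl
    rcases hl with rfl | rfl
    · simp [Lit.var]; omega
    · rw [Lit.negate_var]; omega

theorem mkPhi_false {N m : ℕ} {cl : ℕ → Clause} (h : GoodCl N m cl) :
    ¬ (mkPhi N m cl).IsTrue := by
  intro ht
  simp only [PCNF.IsTrue, mkPhi, truthAux] at ht
  have ht := ht (fun _ => false) (fun _ _ => rfl)
  simp only [if_true] at ht
  obtain ⟨w, -, hw⟩ := ht
  obtain ⟨j, hj, hf⟩ := h.hunsat fun k => w (N + k)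
  obtain ⟨l, hl, hlw⟩ := hw ((cl j).image (Lit.shift N)) (mkPhi_mem.2 (Or.inl ⟨j, hj, rfl⟩))
  obtain ⟨l', hl', rfl⟩ := Finset.mem_image.1 hl
  have := hf l' hl'
  cases l' <;> simp_all [Lit.shift, Lit.eval]

theorem mkPhi_existB {N m : ℕ} {cl : ℕ → Clause} (x : ℕ) :
    (mkPhi N m cl).existB x = decide (N ≤ x ∧ x < 2 * N + m) := by
  have : x < N + (N + m) ↔ x < 2 * N + m := by omega
  simp [PCNF.existB, mkPhi, List.mem_range'_1, this]

theorem mkPhi_univBefore {N m : ℕ} {cl : ℕ → Clause} (x : ℕ) (hx : N ≤ x) :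
    (mkPhi N m cl).univBefore x = List.range N := by
  simp only [PCNF.univBefore, mkPhi, List.flatMap_cons, List.flatMap_nil, List.append_nil]
  rw [List.takeWhile_append_of_pos, List.filterMap_append]
  · have h1 : List.filterMap (fun p : Bool × ℕ => if p.1 = false then some p.2 else none)
        (List.map (fun x => (false, x)) (List.range N)) = List.range N := by
      rw [List.filterMap_map]
      simp
    have h2 : ∀ l : List (Bool × ℕ), (∀ p ∈ l, p.1 = true) →
        List.filterMap (fun p : Bool × ℕ => if p.1 = false then some p.2 else none) l = [] := by
      intro l hl
      rw [List.filterMap_eq_nil_iff]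
      intro p hp; simp [hl p hp]
    rw [h1, h2, List.append_nil]
    intro p hp
    have := List.takeWhile_subset _ hp
    simp at this
    obtain ⟨_, _, rfl⟩ := this; rfl
  · intro p hp
    simp at hp
    obtain ⟨a, ha, rfl⟩ := hp
    simp; omega

/-! ## The pigeonhole clauses -/

def phpAll (n : ℕ) : Clause := (Finset.range ((n + 1) * n)).image Lit.pos
def phpPigeon (n i : ℕ) : Clause := (Finset.range n).image fun j => Lit.pos (i * n + j)
def phpHole (n i i' j : ℕ) : Clause := {Lit.neg (i * n + j), Lit.neg (i' * n + j)}

def phpList (n : ℕ) : List Clause :=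
  phpAll n :: ((List.range (n + 1)).map (phpPigeon n) ++
    (List.range (n + 1)).flatMap fun i => (List.range i).flatMap fun i' =>
      (List.range n).map fun j => phpHole n i i' j)

def phpCl (n j : ℕ) : Clause := (phpList n).getD j ∅

theorem phpList_mem {n : ℕ} {C : Clause} : C ∈ phpList n ↔ C = phpAll n ∨
    (∃ i < n + 1, C = phpPigeon n i) ∨
    ∃ i < n + 1, ∃ i' < i, ∃ j < n, C = phpHole n i i' j := by
  simp only [phpList, List.mem_cons, List.mem_append, List.mem_map, List.mem_flatMap,
    List.mem_range, eq_comm (a := C)]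

theorem phpCl_mem {n j : ℕ} (hj : j < (phpList n).length) : phpCl n j ∈ phpList n := by
  rw [phpCl, List.getD_eq_getElem _ _ hj]; exact List.getElem_mem hj

theorem phpCl_ex {n : ℕ} {C : Clause} (h : C ∈ phpList n) :
    ∃ j < (phpList n).length, phpCl n j = C := by
  obtain ⟨j, hj, rfl⟩ := List.getElem_of_mem h
  exact ⟨j, hj, by rw [phpCl, List.getD_eq_getElem _ _ hj]⟩

theorem phpList_length (n : ℕ) : (phpList n).length ≤ (n + 2) ^ 3 := by
  simp only [phpList, List.length_cons, List.length_append, List.length_map, List.length_range,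
    List.length_flatMap, List.map_const', List.sum_replicate, smul_eq_mul]
  have : ((List.range (n + 1)).map fun i => i * n).sum ≤ (n + 1) * ((n + 1) * n) := by
    have := List.sum_le_card_nsmul ((List.range (n + 1)).map fun i => i * n) ((n + 1) * n) (by
      intro x hx
      simp only [List.mem_map, List.mem_range] at hx
      obtain ⟨a, ha, rfl⟩ := hx
      exact Nat.mul_le_mul_right _ ha.le)
    simpa using this
  nlinarith

theorem idx_lt {n i j : ℕ} (hi : i < n + 1) (hj : j < n) : i * n + j < (n + 1) * n := by
  nlinarith

theorem php_good {n : ℕ} (hn : 0 < n) : GoodCl ((n + 1) * n) (phpList n).length (phpCl n) where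
  hN := by positivity
  hm := by simp [phpList]
  hne := by
    intro j hj
    rcases phpList_mem.1 (phpCl_mem hj) with h | ⟨i, hi, h⟩ | ⟨i, hi, i', hi', j, hj, h⟩ <;> rw [h]
    · simp [phpAll]; omega
    · simp [phpPigeon]; omega
    · simp [phpHole]
  hvar := by
    intro j hj l hl
    rcases phpList_mem.1 (phpCl_mem hj) with h | ⟨i, hi, h⟩ | ⟨i, hi, i', hi', j, hj, h⟩ <;>
      rw [h] at hl
    · obtain ⟨k, hk, rfl⟩ := Finset.mem_image.1 hl
      exact Finset.mem_range.1 hk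
    · obtain ⟨k, hk, rfl⟩ := Finset.mem_image.1 hl
      exact idx_lt hi (Finset.mem_range.1 hk)
    · simp only [phpHole, Finset.mem_insert, Finset.mem_singleton] at hl
      rcases hl with rfl | rfl
      · exact idx_lt hi hj
      · exact idx_lt (by omega) hj
  hinj := by
    intro j hj l hl l' hl' he
    rcases phpList_mem.1 (phpCl_mem hj) with h | ⟨i, hi, h⟩ | ⟨i, hi, i', hi', j, hj, h⟩ <;>
      rw [h] at hl hl'
    · obtain ⟨k, hk, rfl⟩ := Finset.mem_image.1 hl
      obtain ⟨k', hk', rfl⟩ := Finset.mem_image.1 hl'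
      simp [Lit.var] at he; rw [he]
    · obtain ⟨k, hk, rfl⟩ := Finset.mem_image.1 hl
      obtain ⟨k', hk', rfl⟩ := Finset.mem_image.1 hl'
      simp [Lit.var] at he; rw [he]
    · simp only [phpHole, Finset.mem_insert, Finset.mem_singleton] at hl hl'
      rcases hl with rfl | rfl <;> rcases hl' with rfl | rfl <;> simp_all [Lit.var]
  hunsat := by
    intro v
    suffices h : ∃ C ∈ phpList n, ∀ l ∈ C, l.eval v = false by
      obtain ⟨C, hC, hl⟩ := h
      obtain ⟨j, hj, rfl⟩ := phpCl_ex hC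
      exact ⟨j, hj, hl⟩
    by_contra! hcon
    have hp : ∀ i < n + 1, ∃ j < n, v (i * n + j) = true := by
      intro i hi
      obtain ⟨l, hl, hv⟩ := hcon _ (phpList_mem.2 (Or.inr (Or.inl ⟨i, hi, rfl⟩)))
      obtain ⟨j, hj, rfl⟩ := Finset.mem_image.1 hl
      exact ⟨j, Finset.mem_range.1 hj, by simpa [Lit.eval] using hv⟩
    choose! f hf hfv using hp
    obtain ⟨i, hi, i', hi', hne, he⟩ := Finset.exists_ne_map_eq_of_card_lt_of_maps_to
      (s := Finset.range (n + 1)) (t := Finset.range n) (by simp)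
      (f := f) (fun i hi => by simpa using hf i (by simpa using hi))
    have key : ∀ i i', i < n + 1 → i' < i → f i = f i' → False := by
      intro i i' hi hi' he
      obtain ⟨l, hl, hv⟩ := hcon _ (phpList_mem.2 (Or.inr (Or.inr ⟨i, hi, i', hi', f i, hf i hi, rfl⟩)))
      simp only [phpHole, Finset.mem_insert, Finset.mem_singleton] at hl
      rcases hl with rfl | rfl
      · simp [Lit.eval, hfv i hi] at hv
      · rw [he] at hv
        simp [Lit.eval, hfv i' (by omega)] at hv
    simp only [Finset.mem_range] at hi hi'
    rcases lt_or_gt_of_ne hne with h | h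
    · exact key _ _ hi' h he.symm
    · exact key _ _ hi h he
  hfull := by
    intro k hk
    exact ⟨Lit.pos k, by simp [phpCl, phpList, phpAll, hk], rfl⟩

/-- Cells not yet touched by the partial matching `α0` on `Q`. -/
def phpCells {V : Type*} [Fintype V] [DecidableEq V] (o : V) (Q : Finset V) (α : Equiv.Perm V) :
    Finset (V × V) :=
  Finset.univ.filter fun c => c.1 ∉ Q ∧ c.2 ∉ Q.image α ∧ c.2 ≠ o

def phpFam {V : Type*} [Fintype V] [DecidableEq V] (o : V) (g : ℕ) (Ms : Finset (Finset (V × V)))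
    (Q : Finset V) (α : Equiv.Perm V) : Finset (Finset (V × V)) :=
  Ms.filter fun M => (∀ i ∈ Q, (i, α i) ∉ M) ∧ g ^ 2 ≤ (M ∩ phpCells o Q α).card

theorem php_greedy {V : Type*} [Fintype V] [DecidableEq V] (o : V) (g : ℕ)
    (hg : 0 < g) (hV : Fintype.card V = 6 * g) (Ms : Finset (Finset (V × V))) (r : ℕ)
    (hr : r ≤ 3 * g) :
    ∃ (Q : Finset V) (α : Equiv.Perm V), Q.card = r ∧ (∀ i ∈ Q, α i ≠ o) ∧
      (phpFam o g Ms Q α).card * 36 ^ r ≤ Ms.card * 35 ^ r := by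
  induction r with
  | zero =>
    refine ⟨∅, 1, rfl, by simp, ?_⟩
    simp only [pow_zero, mul_one]
    exact Finset.card_le_card (Finset.filter_subset _ _)
  | succ r ih =>
    obtain ⟨Q, α, hQ, hα, hc⟩ := ih (by omega)
    -- find a good cell
    have hcell : ∃ c ∈ phpCells o Q α,
        (phpFam o g Ms Q α).card ≤
          ((phpFam o g Ms Q α).filter fun M => c ∈ M).card * 36 := by
      have hne : (phpCells o Q α).Nonempty := by
        have h1 : ∃ i, i ∉ Q := by
          by_contra! h
          have : Q = Finset.univ := Finset.eq_univ_iff_forall.2 h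
          rw [this, Finset.card_univ] at hQ; omega
        have h2 : ∃ j, j ∉ insert o (Q.image α) := by
          by_contra! h
          have h' : insert o (Q.image α) = Finset.univ := Finset.eq_univ_iff_forall.2 h
          have := Finset.card_insert_le o (Q.image α)
          have h3 := Finset.card_image_le (s := Q) (f := α)
          rw [h', Finset.card_univ] at this; omega
        obtain ⟨i, hi⟩ := h1
        obtain ⟨j, hj⟩ := h2
        rw [Finset.mem_insert, not_or] at hj
        exact ⟨(i, j), by simp only [phpCells, Finset.mem_filter, Finset.mem_univ, true_and]; exact ⟨hi, hj.2, hj.1⟩⟩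
      by_contra! h
      have hsum : ∑ c ∈ phpCells o Q α, ((phpFam o g Ms Q α).filter fun M => c ∈ M).card
          = ∑ M ∈ phpFam o g Ms Q α, (M ∩ phpCells o Q α).card := by
        simp only [Finset.card_filter]
        rw [Finset.sum_comm]
        refine Finset.sum_congr rfl fun M _ => ?_
        rw [← Finset.card_filter]
        congr 1
        ext c; simp [and_comm]
      have hlow : (phpFam o g Ms Q α).card * g ^ 2 ≤
          ∑ M ∈ phpFam o g Ms Q α, (M ∩ phpCells o Q α).card := by
        rw [← smul_eq_mul]
        refine Finset.card_nsmul_le_sum _ _ _ fun M hM => ?_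
        exact (Finset.mem_filter.1 hM).2.2
      have hlt : ∑ c ∈ phpCells o Q α, ((phpFam o g Ms Q α).filter fun M => c ∈ M).card * 36 <
          ∑ c ∈ phpCells o Q α, (phpFam o g Ms Q α).card :=
        Finset.sum_lt_sum_of_nonempty hne h
      rw [← Finset.sum_mul, hsum, Finset.sum_const, smul_eq_mul] at hlt
      have hcc : (phpCells o Q α).card ≤ 36 * g ^ 2 := by
        calc _ ≤ (Finset.univ : Finset (V × V)).card := Finset.card_le_card (Finset.filter_subset _ _)
          _ = 36 * g ^ 2 := by rw [Finset.card_univ, Fintype.card_prod, hV]; ring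
      nlinarith [Nat.mul_le_mul_right (phpFam o g Ms Q α).card hcc]
    obtain ⟨⟨i, j⟩, hij, hbig⟩ := hcell
    simp only [phpCells, Finset.mem_filter, Finset.mem_univ, true_and] at hij
    obtain ⟨hi, hj, hjo⟩ := hij
    have hj' : α.symm j ∉ Q := fun h => hj (Finset.mem_image.2 ⟨_, h, by simp⟩)
    set β : Equiv.Perm V := (Equiv.swap i (α.symm j)).trans α with hβ
    have hβi : β i = j := by simp [hβ]
    have hβQ : ∀ k ∈ Q, β k = α k := by
      intro k hk
      have h1 : k ≠ i := fun h => hi (h ▸ hk)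
      have h2 : k ≠ α.symm j := fun h => hj' (h ▸ hk)
      simp [hβ, Equiv.swap_apply_of_ne_of_ne h1 h2]
    refine ⟨insert i Q, β, by rw [Finset.card_insert_of_notMem hi, hQ], ?_, ?_⟩
    · intro k hk
      rcases Finset.mem_insert.1 hk with rfl | hk
      · rw [hβi]; exact hjo
      · rw [hβQ k hk]; exact hα k hk
    · have hsub : phpFam o g Ms (insert i Q) β ⊆
          (phpFam o g Ms Q α).filter fun M => ¬ (i, j) ∈ M := by
        intro M hM
        simp only [phpFam, Finset.mem_filter] at hM ⊢
        obtain ⟨hMs, h1, h2⟩ := hM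
        refine ⟨⟨hMs, fun k hk => ?_, ?_⟩, ?_⟩
        · rw [← hβQ k hk]; exact h1 k (Finset.mem_insert_of_mem hk)
        · refine h2.trans (Finset.card_le_card (Finset.inter_subset_inter_left ?_))
          intro c hc
          simp only [phpCells, Finset.mem_filter, Finset.mem_univ, true_and] at hc ⊢
          refine ⟨fun h => hc.1 (Finset.mem_insert_of_mem h), fun h => hc.2.1 ?_, hc.2.2⟩
          obtain ⟨k, hk, hk'⟩ := Finset.mem_image.1 h
          exact Finset.mem_image.2 ⟨k, Finset.mem_insert_of_mem hk, by rw [hβQ k hk, hk']⟩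
        · rw [← hβi]; exact h1 i (Finset.mem_insert_self _ _)
      have hle := Finset.card_le_card hsub
      have hsplit := Finset.card_filter_add_card_filter_not (s := phpFam o g Ms Q α) (fun M => (i, j) ∈ M)
      have h3 : (phpFam o g Ms (insert i Q) β).card * 36 ≤ (phpFam o g Ms Q α).card * 35 := by
        omega
      calc _ = ((phpFam o g Ms (insert i Q) β).card * 36) * 36 ^ r := by ring
        _ ≤ ((phpFam o g Ms Q α).card * 35) * 36 ^ r := Nat.mul_le_mul_right _ h3
        _ = ((phpFam o g Ms Q α).card * 36 ^ r) * 35 := by ring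
        _ ≤ (Ms.card * 35 ^ r) * 35 := Nat.mul_le_mul_right _ hc
        _ = _ := by ring

theorem php_lb {V : Type*} [Fintype V] [DecidableEq V] (o : V) (g : ℕ)
    (hg : 0 < g) (hV : Fintype.card V = 6 * g) (len : ℕ) (Sat : ℕ → Equiv.Perm V → Prop)
    (Ms : Finset (Finset (V × V)))
    (hM : ∀ k < len, (∀ α, Sat k α) ∨ ∃ M ∈ Ms, ∀ α, Sat k α ↔ ∃ i, α i ≠ o ∧ (i, α i) ∈ M)
    (hstep : ∀ k < len, (∃ i, ∀ α : Equiv.Perm V, α i ≠ o → Sat k α) ∨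
      (∃ a < k, ∃ b < k, ∀ α, Sat a α → Sat b α → Sat k α))
    (hlast : ∃ k < len, ∀ α, ¬ Sat k α) :
    36 ^ (3 * g) ≤ Ms.card * 35 ^ (3 * g) := by
  obtain ⟨Q, α0, hQ, hα0, hc⟩ := php_greedy o g hg hV Ms (3 * g) le_rfl
  by_contra! hlt
  have hfam : phpFam o g Ms Q α0 = ∅ := by
    rw [← Finset.card_eq_zero]
    by_contra h
    have : 1 ≤ (phpFam o g Ms Q α0).card := Nat.one_le_iff_ne_zero.2 h
    nlinarith [Nat.mul_le_mul_right (36 ^ (3 * g)) this]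
  -- `I` implies line `k`
  let Imp : Finset V → ℕ → Prop := fun I k => ∀ α : Equiv.Perm V, (∀ i ∈ Q, α i = α0 i) →
    (∀ i ∈ I, α i ≠ o) → Sat k α
  have hQc : (Qᶜ).card = 3 * g := by rw [Finset.card_compl, hV, hQ]; omega
  -- a line of measure > g
  have hex : ∃ k, k < len ∧ ¬ ∃ I : Finset V, I ⊆ Qᶜ ∧ I.card ≤ g ∧ Imp I k := by
    obtain ⟨k, hk, hns⟩ := hlast
    refine ⟨k, hk, ?_⟩
    rintro ⟨I, hI, hIc, himp⟩
    have : ∃ i ∈ Qᶜ, i ∉ I := by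
      by_contra! h
      have := Finset.card_le_card (show Qᶜ ⊆ I from h)
      omega
    obtain ⟨i, hi, hiI⟩ := this
    have hiQ : i ∉ Q := Finset.mem_compl.1 hi
    refine hns ((Equiv.swap i (α0.symm o)).trans α0) (himp _ ?_ ?_)
    · intro k hk
      have h1 : k ≠ i := fun h => hiQ (h ▸ hk)
      have h2 : k ≠ α0.symm o := by
        rintro rfl
        exact hα0 _ hk (by simp)
      simp [Equiv.swap_apply_of_ne_of_ne h1 h2]
    · intro k hk h
      have h1 : k ≠ i := fun h => hiI (h ▸ hk)
      rw [Equiv.trans_apply, ← Equiv.eq_symm_apply, Equiv.swap_apply_eq_iff] at h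
      simp at h
      exact h1 h
  classical
  obtain ⟨hklen, hk⟩ := Nat.find_spec hex
  set k := Nat.find hex with hkdef
  have hmin : ∀ a < k, ∃ I : Finset V, I ⊆ Qᶜ ∧ I.card ≤ g ∧ Imp I a := by
    intro a ha
    have := Nat.find_min hex ha
    push Not at this
    exact this (by omega)
  have hmid : ∃ I : Finset V, I ⊆ Qᶜ ∧ I.card ≤ 2 * g ∧ Imp I k := by
    rcases hstep k hklen with ⟨i, hi⟩ | ⟨a, ha, b, hb, hab⟩
    · by_cases hiQ : i ∈ Q
      · exact ⟨∅, by simp, by simp, fun α h1 _ => hi α (by rw [h1 i hiQ]; exact hα0 i hiQ)⟩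
      · exact ⟨{i}, by simpa using hiQ, by simp; omega, fun α _ h2 => hi α (h2 i (by simp))⟩
    · obtain ⟨I, hI, hIc, hIi⟩ := hmin a ha
      obtain ⟨J, hJ, hJc, hJi⟩ := hmin b hb
      refine ⟨I ∪ J, Finset.union_subset hI hJ, (Finset.card_union_le _ _).trans (by omega), ?_⟩
      intro α h1 h2
      exact hab α (hIi α h1 fun i hi => h2 i (Finset.mem_union_left _ hi))
        (hJi α h1 fun i hi => h2 i (Finset.mem_union_right _ hi))
  -- minimal such I
  obtain ⟨I, ⟨hI, hIc, hIi⟩, hImin⟩ : ∃ I : Finset V, (I ⊆ Qᶜ ∧ I.card ≤ 2 * g ∧ Imp I k) ∧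
      ∀ i ∈ I, ¬ Imp (I.erase i) k := by
    have hex2 : ∃ c, ∃ I : Finset V, (I ⊆ Qᶜ ∧ I.card ≤ 2 * g ∧ Imp I k) ∧ I.card = c := by
      obtain ⟨I, h⟩ := hmid
      exact ⟨_, I, h, rfl⟩
    obtain ⟨I, h, hc⟩ := Nat.find_spec hex2
    refine ⟨I, h, fun i hi himp => ?_⟩
    have hlt : (I.erase i).card < I.card := Finset.card_erase_lt_of_mem hi
    refine Nat.find_min hex2 (m := (I.erase i).card) (by omega) ⟨_, ⟨(Finset.erase_subset _ _).trans h.1, by omega, himp⟩, rfl⟩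
  have hIg : g < I.card := by
    by_contra! h
    exact hk ⟨I, hI, h, hIi⟩
  have hcrit : ∀ i ∈ I, ∃ α : Equiv.Perm V, (∀ q ∈ Q, α q = α0 q) ∧ α i = o ∧ ¬ Sat k α := by
    intro i hi
    have := hImin i hi
    simp only [Imp] at this
    push Not at this
    obtain ⟨α, h1, h2, h3⟩ := this
    refine ⟨α, h1, ?_, h3⟩
    by_contra hne
    refine h3 (hIi α h1 fun j hj => ?_)
    by_cases hji : j = i
    · rw [hji]; exact hne
    · exact h2 j (Finset.mem_erase.2 ⟨hji, hj⟩)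
  choose! A hAQ hAo hAs using hcrit
  have hInon : I.Nonempty := Finset.card_pos.1 (by omega)
  obtain ⟨M, hMs, hMk⟩ : ∃ M ∈ Ms, ∀ α, Sat k α ↔ ∃ i, α i ≠ o ∧ (i, α i) ∈ M := by
    rcases hM k hklen with h | h
    · obtain ⟨i, hi⟩ := hInon
      exact absurd (h _) (hAs i hi)
    · exact h
  have hcells : ∀ i ∈ I, ∀ j ∈ Qᶜ \ I, (i, A i j) ∈ M ∩ phpCells o Q α0 := by
    intro i hi j hj
    obtain ⟨hjQ, hjI⟩ := Finset.mem_sdiff.1 hj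
    rw [Finset.mem_compl] at hjQ
    have hiQ : i ∉ Q := Finset.mem_compl.1 (hI hi)
    have hij : i ≠ j := fun h => hjI (h ▸ hi)
    have hAj : A i j ≠ o := by
      intro h
      exact hij ((A i).injective ((hAo i hi).trans h.symm))
    have hsat : Sat k ((Equiv.swap i j).trans (A i)) := by
      apply hIi
      · intro q hq
        have h1 : q ≠ i := fun h => hiQ (h ▸ hq)
        have h2 : q ≠ j := fun h => hjQ (h ▸ hq)
        simp [Equiv.swap_apply_of_ne_of_ne h1 h2, hAQ i hi q hq]
      · intro l hl h
        have : Equiv.swap i j l = i := (A i).injective (h.trans (hAo i hi).symm)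
        rw [Equiv.swap_apply_eq_iff, Equiv.swap_apply_left] at this
        exact hjI (this ▸ hl)
    rw [hMk] at hsat
    obtain ⟨l, hlo, hlM⟩ := hsat
    have hl : l = i := by
      by_contra hli
      by_cases hlj : l = j
      · subst hlj
        simp [hAo i hi] at hlo
      · refine hAs i hi ((hMk _).2 ⟨l, ?_, ?_⟩)
        · simpa [Equiv.swap_apply_of_ne_of_ne hli hlj] using hlo
        · simpa [Equiv.swap_apply_of_ne_of_ne hli hlj] using hlM
    subst hl
    simp at hlM
    rw [Finset.mem_inter]
    refine ⟨hlM, ?_⟩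
    simp only [phpCells, Finset.mem_filter, Finset.mem_univ, true_and]
    refine ⟨hiQ, ?_, hAj⟩
    intro h
    obtain ⟨q, hq, hq'⟩ := Finset.mem_image.1 h
    rw [← hAQ l hi q hq] at hq'
    exact hjQ ((A l).injective hq' ▸ hq)
  have hbig : g ^ 2 ≤ (M ∩ phpCells o Q α0).card := by
    have hinj : ((I ×ˢ (Qᶜ \ I)).image fun c => (c.1, A c.1 c.2)).card = I.card * (Qᶜ \ I).card := by
      rw [Finset.card_image_of_injOn, Finset.card_product]
      rintro ⟨i, j⟩ _ ⟨i', j'⟩ _ h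
      simp only [Prod.mk.injEq] at h ⊢
      obtain ⟨rfl, h2⟩ := h
      exact ⟨rfl, (A i).injective h2⟩
    have hsub : ((I ×ˢ (Qᶜ \ I)).image fun c => (c.1, A c.1 c.2)) ⊆ M ∩ phpCells o Q α0 := by
      intro c hc
      obtain ⟨⟨i, j⟩, hij, rfl⟩ := Finset.mem_image.1 hc
      rw [Finset.mem_product] at hij
      exact hcells i hij.1 j hij.2
    have h1 := Finset.card_le_card hsub
    rw [hinj] at h1
    have h2 : g ≤ (Qᶜ \ I).card := by
      rw [Finset.card_sdiff_of_subset hI, hQc]; omega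
    calc g ^ 2 = g * g := by ring
      _ ≤ I.card * (Qᶜ \ I).card := Nat.mul_le_mul hIg.le h2
      _ ≤ _ := h1
  have : M ∈ phpFam o g Ms Q α0 := by
    simp only [phpFam, Finset.mem_filter]
    refine ⟨hMs, fun i hi hiM => ?_, hbig⟩
    obtain ⟨j, hj⟩ := hInon
    refine hAs j hj ((hMk _).2 ⟨i, ?_, ?_⟩)
    · rw [hAQ j hj i hi]; exact hα0 i hi
    · rw [hAQ j hj i hi]; exact hiM
  rw [hfam] at this
  simp at this


/-! ## Semantic lower bound for EPR -/

def evT (θ : ℕ → Bool) : FTerm → Bool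
  | .var x => θ x
  | .app f _ => f == 1

theorem evT_subst (θ : ℕ → Bool) (σ : ℕ → FTerm) (t : FTerm) :
    evT θ (t.subst σ) = evT (fun x => evT θ (σ x)) t := by
  cases t with
  | var x => simp [FTerm.subst, evT]
  | app f a => rw [FTerm.subst]; simp [evT]

/-- `j` is the first falsified clause. -/
def FirstF (cl : ℕ → Clause) (j : ℕ) (v : ℕ → Bool) : Prop :=
  (∀ l ∈ cl j, l.eval v = false) ∧ ∀ i < j, ∃ l ∈ cl i, l.eval v = true

def evA (N : ℕ) (cl : ℕ → Clause) (a : ℕ → Bool) (p : ℕ) (bits : List Bool) : Prop :=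
  if p = 0 then bits = [true]
  else if N < p ∧ p ≤ 2 * N then a (p - N - 1) = true
  else FirstF cl (p - 2 * N - 1) fun k => bits.getD k false

def evL (N : ℕ) (cl : ℕ → Clause) (a : ℕ → Bool) (θ : ℕ → Bool) : FLit → Prop
  | .pos b => evA N cl a b.p (b.args.map (evT θ))
  | .neg b => ¬ evA N cl a b.p (b.args.map (evT θ))

def EValid (N : ℕ) (cl : ℕ → Clause) (a : ℕ → Bool) (E : FClause) : Prop :=
  ∀ θ, ∃ l ∈ E, evL N cl a θ l

theorem evL_subst (N : ℕ) (cl : ℕ → Clause) (a : ℕ → Bool) (θ : ℕ → Bool) (σ : ℕ → FTerm)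
    (l : FLit) : evL N cl a θ (l.subst σ) ↔ evL N cl a (fun x => evT θ (σ x)) l := by
  have h : ∀ b : FAtom, (b.subst σ).args.map (evT θ) =
      b.args.map (evT fun x => evT θ (σ x)) := by
    intro b
    simp only [FAtom.subst, List.map_map]
    exact List.map_congr_left fun t _ => evT_subst θ σ t
  cases l with
  | pos b => simp only [FLit.subst, evL, h]; rfl
  | neg b => simp only [FLit.subst, evL, h]; rfl

theorem EValid_subst {N : ℕ} {cl : ℕ → Clause} {a : ℕ → Bool} {C : FClause} (σ : ℕ → FTerm)
    (h : EValid N cl a C) : EValid N cl a (C.subst σ) := by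
  intro θ
  obtain ⟨l, hl, hv⟩ := h fun x => evT θ (σ x)
  exact ⟨l.subst σ, Finset.mem_image_of_mem _ hl, (evL_subst ..).2 hv⟩

theorem EValid_factor {N : ℕ} {cl : ℕ → Clause} {a : ℕ → Bool} {C D : FClause}
    (hf : IsFactor C D) (h : EValid N cl a C) : EValid N cl a D := by
  obtain ⟨K, L, σ, -, -, -, -, -, rfl⟩ := hf
  exact EValid_subst σ h

theorem EValid_resolvent {N : ℕ} {cl : ℕ → Clause} {a : ℕ → Bool} {C D E : FClause}
    (hf : IsResolvent C D E) (hC : EValid N cl a C) (hD : EValid N cl a D) :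
    EValid N cl a E := by
  obtain ⟨ρ, -, K, L, σ, -, -, -, hs, hu, rfl⟩ := hf
  have hC' := EValid_subst σ hC
  have hD' := EValid_subst σ (EValid_subst (renameSub ρ) hD)
  intro θ
  obtain ⟨l, hl, hv⟩ := hC' θ
  obtain ⟨l', hl', hv'⟩ := hD' θ
  by_cases h1 : l = K.subst σ
  · by_cases h2 : l' = L.subst σ
    · exfalso
      have hu := hu.1
      subst h1 h2
      unfold Unifies at hu
      cases K <;> cases L <;> simp_all [FLit.isPos, FLit.atom, FLit.subst, evL]
    · exact ⟨l', Finset.mem_union_right _ (Finset.mem_erase.2 ⟨h2, hl'⟩), hv'⟩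
  · exact ⟨l, Finset.mem_union_left _ (Finset.mem_erase.2 ⟨h1, hl⟩), hv⟩

def IsD (N : ℕ) (l : FLit) : Prop := N < l.atom.p ∧ l.atom.p ≤ 2 * N

def dSat (N : ℕ) (a : ℕ → Bool) : FLit → Prop
  | .pos b => a (b.p - N - 1) = true
  | .neg b => ¬ a (b.p - N - 1) = true

theorem evL_D {N : ℕ} {cl : ℕ → Clause} {a : ℕ → Bool} {θ : ℕ → Bool} {l : FLit} (h : IsD N l) :
    evL N cl a θ l ↔ dSat N a l := by
  unfold IsD at h
  cases l with
  | pos b =>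
    simp only [FLit.atom] at h
    simp only [evL, evA, dSat, if_neg (show b.p ≠ 0 by omega), if_pos h]
  | neg b =>
    simp only [FLit.atom] at h
    simp only [evL, evA, dSat, if_neg (show b.p ≠ 0 by omega), if_pos h]

theorem evL_nD {N : ℕ} {cl : ℕ → Clause} (a a' : ℕ → Bool) {θ : ℕ → Bool} {l : FLit}
    (h : ¬ IsD N l) : evL N cl a θ l ↔ evL N cl a' θ l := by
  unfold IsD at h
  cases l with
  | pos b =>
    simp only [FLit.atom] at h
    simp only [evL, evA, if_neg h]
  | neg b =>
    simp only [FLit.atom] at h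
    simp only [evL, evA, if_neg h]

theorem EValid_split {N : ℕ} {cl : ℕ → Clause} (E : FClause) :
    (∀ a, EValid N cl a E) ∨ ∀ a, EValid N cl a E ↔ ∃ l ∈ E, IsD N l ∧ dSat N a l := by
  by_cases hd : ∀ θ, ∃ l ∈ E, ¬ IsD N l ∧ evL N cl (fun _ => false) θ l
  · left
    intro a θ
    obtain ⟨l, hl, h1, h2⟩ := hd θ
    exact ⟨l, hl, (evL_nD _ _ h1).1 h2⟩
  · right
    push Not at hd
    obtain ⟨θ0, h0⟩ := hd
    intro a
    constructor
    · intro h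
      obtain ⟨l, hl, hv⟩ := h θ0
      by_cases hD : IsD N l
      · exact ⟨l, hl, hD, (evL_D hD).1 hv⟩
      · exact absurd ((evL_nD _ _ hD).1 hv) (h0 l hl hD)
    · rintro ⟨l, hl, hD, hs⟩ θ
      exact ⟨l, hl, (evL_D hD).2 hs⟩

theorem eprLit_D {N m : ℕ} {cl : ℕ → Clause} {k : ℕ} (hk : k < N) :
    eprAtom (mkPhi N m cl) (N + k) = ⟨N + k + 1, (List.range N).map FTerm.var⟩ := by
  rw [eprAtom, mkPhi_existB, mkPhi_univBefore _ (by omega), if_pos (by simp; omega), if_neg]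
  simp; omega

theorem eprLit_E {N m : ℕ} {cl : ℕ → Clause} (hN : 0 < N) {j : ℕ} (hj : j < m) :
    eprAtom (mkPhi N m cl) (2 * N + j) = ⟨2 * N + j + 1, (List.range N).map FTerm.var⟩ := by
  rw [eprAtom, mkPhi_existB, mkPhi_univBefore _ (by omega), if_pos (by simp; omega), if_neg]
  simp; omega

theorem eprLit_U {N m : ℕ} {cl : ℕ → Clause} {k : ℕ} (hk : k < N) :
    eprAtom (mkPhi N m cl) k = ⟨0, [FTerm.var k]⟩ := by
  rw [eprAtom, mkPhi_existB, if_neg (by simp; omega)]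

theorem evA_D {N m : ℕ} {cl : ℕ → Clause} {a : ℕ → Bool} {θ : ℕ → Bool} {k : ℕ} (hk : k < N) :
    evA N cl a (eprAtom (mkPhi N m cl) (N + k)).p
      ((eprAtom (mkPhi N m cl) (N + k)).args.map (evT θ)) ↔ a k = true := by
  rw [eprLit_D hk]
  simp only [evA]
  rw [if_neg (by omega), if_pos (by omega), show N + k + 1 - N - 1 = k by omega]

theorem FirstF_congr {N j : ℕ} {cl : ℕ → Clause} {v w : ℕ → Bool}
    (hv : ∀ i ≤ j, ∀ l ∈ cl i, l.var < N) (h : ∀ k < N, v k = w k) :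
    FirstF cl j v ↔ FirstF cl j w := by
  have : ∀ i ≤ j, ∀ l ∈ cl i, l.eval v = l.eval w := by
    intro i hi l hl
    have := h _ (hv i hi l hl)
    cases l <;> simp_all [Lit.eval, Lit.var]
  unfold FirstF
  apply and_congr
  · exact forall₂_congr fun l hl => by rw [this j le_rfl l hl]
  · refine forall₂_congr fun i hi => exists_congr fun l => and_congr_right fun hl => by
      rw [this i hi.le l hl]

theorem evA_E {N m : ℕ} {cl : ℕ → Clause} {a : ℕ → Bool} {θ : ℕ → Bool} (h : GoodCl N m cl)
    {j : ℕ} (hj : j < m) :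
    evA N cl a (eprAtom (mkPhi N m cl) (2 * N + j)).p
      ((eprAtom (mkPhi N m cl) (2 * N + j)).args.map (evT θ)) ↔ FirstF cl j θ := by
  rw [eprLit_E h.hN hj]
  simp only [evA]
  rw [if_neg (by omega), if_neg (by omega), show 2 * N + j + 1 - 2 * N - 1 = j by omega]
  apply FirstF_congr (N := N) (fun i hi => h.hvar i (by omega))
  intro k hk
  simp [List.getD_eq_getElem?_getD, hk, evT]

theorem evA_U {N m : ℕ} {cl : ℕ → Clause} {a : ℕ → Bool} {θ : ℕ → Bool} {k : ℕ} (hk : k < N) :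
    evA N cl a (eprAtom (mkPhi N m cl) k).p
      ((eprAtom (mkPhi N m cl) k).args.map (evT θ)) ↔ θ k = true := by
  rw [eprLit_U hk]
  simp [evA, evT]

theorem EValid_ax {N m : ℕ} {cl : ℕ → Clause} (h : GoodCl N m cl) {E : FClause}
    (hE : E ∈ eprSet (mkPhi N m cl)) : (∀ a, EValid N cl a E) ∨
      ∃ j < m, ∀ a, (∃ l ∈ cl j, l.eval a = true) → EValid N cl a E := by
  rcases hE with hE | hE | hE
  · obtain ⟨C, hC, rfl⟩ := Finset.mem_image.1 hE
    rcases mkPhi_mem.1 hC with ⟨j, hj, rfl⟩ | rfl | ⟨j, hj, l, hl, rfl⟩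
    · right
      refine ⟨j, hj, fun a ⟨l, hl, hla⟩ θ => ?_⟩
      refine ⟨eprLit _ (l.shift N), Finset.mem_image_of_mem _ (Finset.mem_image_of_mem _ hl), ?_⟩
      have hlt := h.hvar j hj l hl
      cases l with
      | pos k => exact (evA_D hlt).2 hla
      | neg k =>
        simp only [Lit.shift, eprLit, evL]
        rw [evA_D (k := k) hlt]; simpa [Lit.eval] using hla
    · left
      intro a θ
      have hex : ∃ j, j < m ∧ ∀ l ∈ cl j, l.eval θ = false := by
        obtain ⟨j, h1, h2⟩ := h.hunsat θ
        exact ⟨j, h1, h2⟩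
      classical
      obtain ⟨hj, hf⟩ := Nat.find_spec hex
      refine ⟨eprLit _ (Lit.pos (2 * N + Nat.find hex)), Finset.mem_image_of_mem _
        (Finset.mem_image.2 ⟨_, Finset.mem_range.2 hj, rfl⟩), ?_⟩
      refine (evA_E h hj).2 ⟨hf, fun i hi => ?_⟩
      have := Nat.find_min hex hi
      push Not at this
      obtain ⟨l, hl, hv⟩ := this (by omega)
      exact ⟨l, hl, by simpa using hv⟩
    · left
      intro a θ
      by_cases hf : FirstF cl j θ
      · refine ⟨eprLit _ l.negate, Finset.mem_image_of_mem _ (by simp), ?_⟩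
        have h1 := hf.1 l hl
        have hlt := h.hvar j hj l hl
        cases l with
        | pos k =>
          simp only [Lit.negate, eprLit, evL]
          rw [evA_U (k := k) hlt]; simpa [Lit.eval] using h1
        | neg k => exact (evA_U (k := k) hlt).2 (by simpa [Lit.eval] using h1)
      · refine ⟨eprLit _ (Lit.neg (2 * N + j)), Finset.mem_image_of_mem _ (by simp), ?_⟩
        simp only [eprLit, evL]
        rwa [evA_E h hj]
  · left
    intro a θ
    rw [hE]
    exact ⟨_, Finset.mem_singleton_self _, by simp [evL, evA, evT]⟩
  · left
    intro a θ
    rw [hE]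
    exact ⟨_, Finset.mem_singleton_self _, by simp [evL, evA, evT]⟩

noncomputable def phpBit (n : ℕ) (α : Equiv.Perm (Fin (n + 1))) (k : ℕ) : Bool :=
  @decide (∃ i : Fin (n + 1), i.val = k / n ∧ (α i).val = k % n) (Classical.dec _)

def litCell (n k : ℕ) (b : Bool) (c : Fin (n + 1) × Fin (n + 1)) : Prop :=
  c.2.val = k % n ∧ if b then c.1.val = k / n else c.1.val ≠ k / n

noncomputable def clauseM (n : ℕ) (E : FClause) : Finset (Fin (n + 1) × Fin (n + 1)) :=
  @Finset.filter _ (fun c => ∃ l ∈ E, IsD ((n + 1) * n) l ∧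
    litCell n (l.atom.p - (n + 1) * n - 1) l.isPos c) (Classical.decPred _) Finset.univ

theorem dSat_cell {n : ℕ} (hn : 0 < n) (α : Equiv.Perm (Fin (n + 1))) (l : FLit) 
    (N : ℕ) : dSat N (phpBit n α) l ↔
      ∃ i, α i ≠ Fin.last n ∧ litCell n (l.atom.p - N - 1) l.isPos (i, α i) := by
  have hlast : ∀ (k : ℕ) (x : Fin (n + 1)), x.val = k % n → x ≠ Fin.last n := by
    intro k x hx h
    have := Nat.mod_lt k hn
    rw [h] at hx; simp at hx; omega
  cases l with
  | pos b =>
    simp only [dSat, phpBit, decide_eq_true_eq, FLit.atom, FLit.isPos, litCell, if_true]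
    constructor
    · rintro ⟨i, h1, h2⟩; exact ⟨i, hlast _ _ h2, h2, h1⟩
    · rintro ⟨i, -, h2, h1⟩; exact ⟨i, h1, h2⟩
  | neg b =>
    simp only [dSat, phpBit, decide_eq_true_eq, FLit.atom, FLit.isPos, litCell, Bool.false_eq_true,
      if_false]
    set k := b.p - N - 1
    constructor
    · intro h
      refine ⟨α.symm ⟨k % n, (Nat.mod_lt k hn).trans (Nat.lt_succ_self _)⟩, ?_, ?_, ?_⟩
      · apply hlast k; simp
      · simp
      · intro h'
        exact h ⟨_, h', by simp⟩
    · rintro ⟨i, -, h2, h1⟩ ⟨i', h3, h4⟩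
      apply h1
      rw [← h3, α.injective (Fin.ext (h2.trans h4.symm))]

theorem php_cl_sat {n : ℕ} (hn : 0 < n) {C : Clause} (hC : C ∈ phpList n) :
    ∃ i : Fin (n + 1), ∀ α : Equiv.Perm (Fin (n + 1)), α i ≠ Fin.last n →
      ∃ l ∈ C, l.eval (phpBit n α) = true := by
  have hdiv : ∀ i j : ℕ, j < n → (i * n + j) / n = i := by
    intro i j hj
    rw [mul_comm, Nat.mul_add_div hn, Nat.div_eq_of_lt hj, add_zero]
  have hmod : ∀ i j : ℕ, j < n → (i * n + j) % n = j := by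
    intro i j hj
    rw [mul_comm, Nat.mul_add_mod, Nat.mod_eq_of_lt hj]
  rcases phpList_mem.1 hC with rfl | ⟨i, hi, rfl⟩ | ⟨i, hi, i', hi', j, hj, rfl⟩
  · refine ⟨0, fun α hα => ?_⟩
    have hj : (α 0).val < n := Fin.val_lt_last hα
    refine ⟨Lit.pos (α 0).val, ?_, ?_⟩
    · refine Finset.mem_image_of_mem _ (Finset.mem_range.2 ?_)
      nlinarith
    · simp only [Lit.eval, phpBit, decide_eq_true_eq]
      exact ⟨0, by simp [Nat.div_eq_of_lt hj], (Nat.mod_eq_of_lt hj).symm⟩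
  · refine ⟨⟨i, hi⟩, fun α hα => ?_⟩
    have hj : (α ⟨i, hi⟩).val < n := Fin.val_lt_last hα
    refine ⟨Lit.pos (i * n + (α ⟨i, hi⟩).val), ?_, ?_⟩
    · exact Finset.mem_image.2 ⟨_, Finset.mem_range.2 hj, rfl⟩
    · simp only [Lit.eval, phpBit, decide_eq_true_eq]
      exact ⟨⟨i, hi⟩, by rw [hdiv _ _ hj], by rw [hmod _ _ hj]⟩
  · refine ⟨0, fun α _ => ?_⟩
    by_cases h : phpBit n α (i * n + j) = true
    · refine ⟨Lit.neg (i' * n + j), by simp [phpHole], ?_⟩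
      simp only [Lit.eval, Bool.not_eq_true', Bool.eq_false_iff]
      intro h'
      simp only [phpBit, decide_eq_true_eq, hdiv _ _ hj, hmod _ _ hj] at h h'
      obtain ⟨a, rfl, ha⟩ := h
      obtain ⟨b, rfl, hb⟩ := h'
      have := α.injective (Fin.ext (ha.trans hb.symm))
      subst this; omega
    · exact ⟨Lit.neg (i * n + j), by simp [phpHole], by simpa [Lit.eval] using h⟩

theorem FLit.symSize_pos (l : FLit) : 0 < l.symSize := by
  cases l <;> simp [FLit.symSize, FAtom.symSize]

theorem card_le_r1Size (ρ : List FClause) : ρ.toFinset.card ≤ r1Size ρ + 1 := by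
  induction ρ with
  | nil => simp
  | cons C ρ ih =>
    have hs : r1Size (C :: ρ) = C.symSize + r1Size ρ := by simp [r1Size]
    by_cases hC : C = ∅
    · subst hC
      clear ih
      have : ((∅ : FClause) :: ρ).toFinset.erase ∅ ⊆ ρ.toFinset.erase ∅ := by
        intro x hx; simp at hx ⊢; tauto
      have h1 := Finset.card_le_card this
      have h2 : ∀ ρ : List FClause, (ρ.toFinset.erase ∅).card ≤ r1Size ρ := by
        intro ρ
        induction ρ with
        | nil => simp
        | cons C ρ ih =>
          have hs : r1Size (C :: ρ) = C.symSize + r1Size ρ := by simp [r1Size]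
          by_cases hC : C = ∅
          · subst hC
            have : ((∅ : FClause) :: ρ).toFinset.erase ∅ ⊆ ρ.toFinset.erase ∅ := by
              intro x hx; simp at hx ⊢; tauto
            have := Finset.card_le_card this
            omega
          · have hpos : 0 < C.symSize := by
              obtain ⟨l, hl⟩ := Finset.nonempty_iff_ne_empty.2 hC
              exact Finset.sum_pos (fun l _ => l.symSize_pos) ⟨l, hl⟩
            have : (C :: ρ).toFinset.erase ∅ ⊆ insert C (ρ.toFinset.erase ∅) := by
              intro x hx; simp at hx ⊢; tauto
            have := (Finset.card_le_card this).trans (Finset.card_insert_le _ _)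
            omega
      have h3 := h2 ρ
      have h4 := Finset.pred_card_le_card_erase (s := ((∅ : FClause) :: ρ).toFinset) (a := ∅)
      omega
    · have hpos : 0 < C.symSize := by
        obtain ⟨l, hl⟩ := Finset.nonempty_iff_ne_empty.2 hC
        exact Finset.sum_pos (fun l _ => l.symSize_pos) ⟨l, hl⟩
      rw [List.toFinset_cons]
      have := Finset.card_insert_le C ρ.toFinset
      omega

theorem epr_lower {g n : ℕ} (hg : 0 < g) (hn : n + 1 = 6 * g) {ρ : List FClause}
    (hρ : R1Refutation (eprSet (mkPhi ((n + 1) * n) (phpList n).length (phpCl n))) ρ) :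
    36 ^ (3 * g) ≤ (r1Size ρ + 1) * 35 ^ (3 * g) := by
  have hn0 : 0 < n := by omega
  have hgood := php_good hn0
  set N := (n + 1) * n with hN
  obtain ⟨hval, hne, hlast⟩ := hρ
  have key := php_lb (V := Fin (n + 1)) (Fin.last n) g hg (by simp [hn]) ρ.length
    (fun k α => EValid N (phpCl n) (phpBit n α) ρ[k]!)
    (ρ.toFinset.image (clauseM n)) ?_ ?_ ?_
  · refine key.trans (Nat.mul_le_mul_right _ ?_)
    exact Finset.card_image_le.trans (card_le_r1Size ρ)
  · intro k hk
    rcases EValid_split (N := N) (cl := phpCl n) ρ[k]! with h | h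
    · exact Or.inl fun α => h _
    · right
      refine ⟨clauseM n ρ[k]!, Finset.mem_image_of_mem _ ?_, fun α => ?_⟩
      · rw [List.mem_toFinset, getElem!_pos ρ k hk]; exact List.getElem_mem hk
      · simp only [h, clauseM, Finset.mem_filter, Finset.mem_univ, true_and]
        constructor
        · rintro ⟨l, hl, hD, hs⟩
          obtain ⟨i, h1, h2⟩ := (dSat_cell hn0 α l N).1 hs
          exact ⟨i, h1, l, hl, hD, h2⟩
        · rintro ⟨i, h1, l, hl, hD, h2⟩
          exact ⟨l, hl, hD, (dSat_cell hn0 α l N).2 ⟨i, h1, h2⟩⟩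
  · intro k hk
    rcases hval k hk with h | ⟨j, hj, hf⟩ | ⟨i, hi, j, hj, hr⟩
    · left
      rcases EValid_ax hgood h with h | ⟨j, hj, h⟩
      · exact ⟨0, fun α _ => h _⟩
      · obtain ⟨i, hi⟩ := php_cl_sat hn0 (phpCl_mem hj)
        exact ⟨i, fun α hα => h _ (hi α hα)⟩
    · right
      exact ⟨j, hj, j, hj, fun α h _ => EValid_factor hf h⟩
    · right
      exact ⟨i, hi, j, hj, fun α h1 h2 => EValid_resolvent hr h1 h2⟩
  · have hpos : 0 < ρ.length := List.length_pos_iff.2 hne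
    refine ⟨ρ.length - 1, by omega, fun α h => ?_⟩
    have : ρ[ρ.length - 1]! = ∅ := by
      rw [← hlast, getElem!_pos ρ _ (by omega), List.getLast!_eq_getLast?_getD,
        List.getLast?_eq_getElem?]
      simp [hpos]
    simp only [this] at h
    obtain ⟨l, hl, -⟩ := h fun _ => false
    simp at hl


/-! ## Short tree refutations of the Skolem translation -/

theorem FTerm.subst_var (σ : ℕ → FTerm) (x : ℕ) : (FTerm.var x).subst σ = σ x := by
  rw [FTerm.subst]

theorem FTerm.subst_app (σ : ℕ → FTerm) (f : ℕ) (as : List FTerm) :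
    (FTerm.app f as).subst σ = .app f (as.map (FTerm.subst σ)) := by
  rw [FTerm.subst]; simp

theorem FTerm.size_app (f : ℕ) (as : List FTerm) :
    (FTerm.app f as).symSize = 1 + (as.map FTerm.symSize).sum := by
  rw [FTerm.symSize]; simp

theorem FTerm.size_var (x : ℕ) : (FTerm.var x).symSize = 1 := by rw [FTerm.symSize]

theorem mem_foldr_union {x : ℕ} (l : List (Finset ℕ)) :
    x ∈ l.foldr (· ∪ ·) ∅ ↔ ∃ s ∈ l, x ∈ s := by
  induction l with
  | nil => simp
  | cons a l ih => simp [ih]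

theorem FTerm.mem_vars_var {x y : ℕ} : x ∈ (FTerm.var y).vars ↔ x = y := by
  rw [FTerm.vars]; simp

theorem FTerm.mem_vars_app {x f : ℕ} {as : List FTerm} :
    x ∈ (FTerm.app f as).vars ↔ ∃ t ∈ as, x ∈ t.vars := by
  rw [FTerm.vars, mem_foldr_union]; simp

theorem FTerm.vars_rename (ρ : ℕ → ℕ) (t : FTerm) :
    ∀ x ∈ (t.subst (renameSub ρ)).vars, ∃ y, x = ρ y := by
  match t with
  | .var y =>
    intro x hx
    rw [FTerm.subst_var, renameSub, FTerm.mem_vars_var] at hx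
    exact ⟨y, hx⟩
  | .app f as =>
    intro x hx
    rw [FTerm.subst_app, FTerm.mem_vars_app] at hx
    obtain ⟨t, ht, hx⟩ := hx
    obtain ⟨s, hs, rfl⟩ := List.mem_map.1 ht
    exact FTerm.vars_rename ρ s x hx
termination_by sizeOf t
decreasing_by
  have := List.sizeOf_lt_of_mem hs
  simp only [FTerm.app.sizeOf_spec]; omega

theorem FClause.mem_fvars {x : ℕ} {C : FClause} :
    x ∈ C.fvars ↔ ∃ l ∈ C, ∃ t ∈ l.atom.args, x ∈ t.vars := by
  simp only [FClause.fvars, Finset.mem_sup, FAtom.vars, mem_foldr_union, List.mem_map,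
    exists_exists_and_eq_and]

theorem FClause.fvars_rename (ρ : ℕ → ℕ) (C : FClause) :
    ∀ x ∈ (FClause.subst (renameSub ρ) C).fvars, ∃ y, x = ρ y := by
  intro x hx
  obtain ⟨l, hl, t, ht, hx⟩ := FClause.mem_fvars.1 hx
  obtain ⟨l', hl', rfl⟩ := Finset.mem_image.1 hl
  have : t ∈ l'.atom.args.map (FTerm.subst (renameSub ρ)) := by
    cases l' <;> exact ht
  obtain ⟨s, _, rfl⟩ := List.mem_map.1 this
  exact FTerm.vars_rename ρ s x hx

theorem isMGU_of {σ : ℕ → FTerm} {a b : FAtom} (h : Unifies σ a b)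
    (h2 : ∀ τ, Unifies τ a b → ∀ x, (σ x).subst τ = τ x) : IsMGU σ a b :=
  ⟨h, fun τ hτ => ⟨τ, h2 τ hτ⟩⟩

def Der (S : Set FClause) (C : FClause) (s : ℕ) : Prop := ∃ t : R1Tree S C, t.size ≤ s

theorem Der.input {S : Set FClause} {C : FClause} {s : ℕ} (h : C ∈ S) (hs : C.symSize ≤ s) :
    Der S C s := ⟨.input C h, by simpa [R1Tree.size] using hs⟩

theorem Der.factor {S : Set FClause} {C D : FClause} {s b : ℕ} (h : Der S C s)
    (hf : IsFactor C D) (hs : D.symSize ≤ b) : Der S D (s + b) := by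
  obtain ⟨t, ht⟩ := h
  exact ⟨.factor t D hf, by simp only [R1Tree.size]; omega⟩

theorem Der.resolve {S : Set FClause} {C D E : FClause} {s s' b : ℕ} (h : Der S C s)
    (h' : Der S D s') (o : ℕ) (hC : ∀ x ∈ C.fvars, x < o) (K L : FLit) (σ : ℕ → FTerm)
    (hK : K ∈ C) (hL : L ∈ FClause.subst (renameSub (o + ·)) D) (hs : K.isPos = !L.isPos)
    (hm : IsMGU σ K.atom L.atom)
    (hE : ((C.subst σ).erase (K.subst σ)) ∪
          (((FClause.subst (renameSub (o + ·)) D).subst σ).erase (L.subst σ)) = E)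
    (hb : E.symSize ≤ b) : Der S E (s + s' + b) := by
  obtain ⟨t, ht⟩ := h
  obtain ⟨t', ht'⟩ := h'
  have hres : IsResolvent C D E := by
    refine ⟨(o + ·), add_right_injective o, K, L, σ, ?_, hK, hL, hs, hm, hE.symm⟩
    rw [Finset.disjoint_left]
    intro x hx hx'
    obtain ⟨y, rfl⟩ := FClause.fvars_rename _ _ x hx'
    have := hC _ hx
    simp at this
  exact ⟨.resolve t t' E hres, by simp only [R1Tree.size]; omega⟩

/-! ### The terms -/

def sg (b : Bool) (a : FAtom) : FLit := if b then .pos a else .neg a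

theorem sg_atom (b : Bool) (a : FAtom) : (sg b a).atom = a := by cases b <;> rfl
theorem sg_isPos (b : Bool) (a : FAtom) : (sg b a).isPos = b := by cases b <;> rfl
theorem sg_subst (σ : ℕ → FTerm) (b : Bool) (a : FAtom) :
    (sg b a).subst σ = sg b (a.subst σ) := by cases b <;> rfl
theorem sg_size (b : Bool) (a : FAtom) : (sg b a).symSize ≤ 1 + a.symSize := by
  cases b <;> simp [sg, FLit.symSize]
theorem sg_inj {b b' : Bool} {a a' : FAtom} : sg b a = sg b' a' ↔ b = b' ∧ a = a' := by
  cases b <;> cases b' <;> simp [sg]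

def dT (N k : ℕ) : FTerm := .app (N + k + 2) ((List.range N).map .var)
def eA (N j : ℕ) (t : ℕ → FTerm) : FAtom := ⟨0, [.app (2 * N + j + 2) ((List.range N).map t)]⟩
def dlit (N : ℕ) (l : Lit) : FLit := sg l.isPos ⟨0, [dT N l.var]⟩
def hlit (t : FTerm) (l : Lit) : FLit := sg (!l.isPos) ⟨0, [t]⟩

theorem dT_subst (N k : ℕ) (σ : ℕ → FTerm) :
    (dT N k).subst σ = .app (N + k + 2) ((List.range N).map σ) := by
  rw [dT, FTerm.subst_app, List.map_map]
  congr 1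
  exact List.map_congr_left fun x _ => FTerm.subst_var σ x

theorem dT_subst_id {N : ℕ} (k : ℕ) {σ : ℕ → FTerm} (h : ∀ x < N, σ x = .var x) :
    (dT N k).subst σ = dT N k := by
  rw [dT_subst, dT]
  congr 1
  exact List.map_congr_left fun x hx => h x (List.mem_range.1 hx)

theorem eA_subst (N j : ℕ) (t : ℕ → FTerm) (σ : ℕ → FTerm) :
    (eA N j t).subst σ = eA N j fun k => (t k).subst σ := by
  simp [eA, FAtom.subst, FTerm.subst_app]

theorem eA_eq {N j j' : ℕ} {t t' : ℕ → FTerm} :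
    eA N j t = eA N j' t' ↔ j = j' ∧ ∀ k < N, t k = t' k := by
  simp [eA]

theorem eA_congr {N j : ℕ} {t t' : ℕ → FTerm} (h : ∀ k < N, t k = t' k) :
    eA N j t = eA N j t' := eA_eq.2 ⟨rfl, h⟩

theorem hlit_ne_eA {N j k : ℕ} (hk : k < N) {b b' : Bool} {t : ℕ → FTerm} {as : List FTerm} :
    sg b ⟨0, [.app (N + k + 2) as]⟩ ≠ sg b' (eA N j t) := by
  intro h
  have := (sg_inj.1 h).2
  simp [eA] at this
  omega

theorem dlit_inj {N : ℕ} {l l' : Lit} (h : dlit N l = dlit N l') : l = l' := by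
  obtain ⟨h1, h2⟩ := sg_inj.1 h
  simp [dT] at h2
  cases l <;> cases l' <;> simp_all [Lit.isPos, Lit.var]

theorem dlit_subst {N : ℕ} (l : Lit) {σ : ℕ → FTerm} (h : ∀ x < N, σ x = .var x) :
    (dlit N l).subst σ = dlit N l := by
  rw [dlit, sg_subst]
  simp [FAtom.subst, dT_subst_id _ h]

theorem dlits_subst {N : ℕ} (R : Clause) {σ : ℕ → FTerm} (h : ∀ x < N, σ x = .var x) :
    FClause.subst σ (R.image (dlit N)) = R.image (dlit N) := by
  rw [FClause.subst, Finset.image_image]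
  exact Finset.image_congr fun l _ => dlit_subst l h

theorem mem_vars_dT {N k x : ℕ} : x ∈ (dT N k).vars ↔ x < N := by
  simp [dT, FTerm.mem_vars_app, FTerm.mem_vars_var]

theorem mem_vars_eA {N x f : ℕ} {t : ℕ → FTerm} :
    x ∈ (FTerm.app f ((List.range N).map t)).vars ↔ ∃ k < N, x ∈ (t k).vars := by
  simp [FTerm.mem_vars_app]

theorem dT_size (N k : ℕ) : (dT N k).symSize = N + 1 := by
  have : FTerm.symSize ∘ FTerm.var = fun _ => 1 := by
    funext x; exact FTerm.size_var x
  rw [dT, FTerm.size_app, List.map_map, this]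
  simp; omega

theorem dlit_size (N : ℕ) (l : Lit) : (dlit N l).symSize ≤ (N + 3) ^ 2 := by
  refine (sg_size _ _).trans ?_
  simp only [FAtom.symSize, List.map_cons, List.map_nil, List.sum_cons, List.sum_nil, dT_size]
  nlinarith

theorem eA_size {N j : ℕ} {b : Bool} {t : ℕ → FTerm} (h : ∀ k < N, (t k).symSize ≤ N + 1) :
    (sg b (eA N j t)).symSize ≤ (N + 3) ^ 2 := by
  refine (sg_size _ _).trans ?_
  simp only [FAtom.symSize, eA, List.map_cons, List.map_nil, List.sum_cons, List.sum_nil,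
    FTerm.size_app, List.map_map]
  have := List.sum_le_card_nsmul ((List.range N).map (FTerm.symSize ∘ t)) (N + 1) (by
    intro x hx
    obtain ⟨k, hk, rfl⟩ := List.mem_map.1 hx
    exact h k (List.mem_range.1 hk))
  simp at this
  nlinarith

theorem clause_size {C : FClause} {B c W : ℕ} (h : ∀ l ∈ C, l.symSize ≤ B) (hc : C.card ≤ c)
    (hW : c * B ≤ W) : C.symSize ≤ W := by
  have := Finset.sum_le_card_nsmul C _ B h
  rw [smul_eq_mul] at this
  exact (this.trans (Nat.mul_le_mul_right _ hc)).trans hW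

/-! ### Input clauses -/

theorem skAtom_D {N m : ℕ} {cl : ℕ → Clause} {k : ℕ} (hk : k < N) :
    skAtom (mkPhi N m cl) (N + k) = ⟨0, [dT N k]⟩ := by
  rw [skAtom, mkPhi_existB, mkPhi_univBefore _ (by omega), if_pos (by simp; omega)]
  rfl

theorem skAtom_E {N m : ℕ} {cl : ℕ → Clause} {j : ℕ} (hj : j < m) :
    skAtom (mkPhi N m cl) (2 * N + j) = eA N j .var := by
  rw [skAtom, mkPhi_existB, mkPhi_univBefore _ (by omega), if_pos (by simp; omega)]
  rfl

theorem skAtom_U {N m : ℕ} {cl : ℕ → Clause} {k : ℕ} (hk : k < N) :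
    skAtom (mkPhi N m cl) k = ⟨0, [.var k]⟩ := by
  rw [skAtom, mkPhi_existB, if_neg (by simp; omega)]

theorem in_D {N m : ℕ} {cl : ℕ → Clause} (h : GoodCl N m cl) {j : ℕ} (hj : j < m) :
    (cl j).image (dlit N) ∈ skSet (mkPhi N m cl) := by
  left
  refine Finset.mem_image.2 ⟨_, mkPhi_mem.2 (Or.inl ⟨j, hj, rfl⟩), ?_⟩
  rw [skClause, Finset.image_image]
  refine Finset.image_congr fun l hl => ?_
  have := h.hvar j hj l hl
  cases l with
  | pos k => simp only [Function.comp, Lit.shift, skLit, skAtom_D (k := k) this]; rfl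
  | neg k => simp only [Function.comp, Lit.shift, skLit, skAtom_D (k := k) this]; rfl

theorem in_Big {N m : ℕ} {cl : ℕ → Clause} :
    (Finset.range m).image (fun j => sg true (eA N j .var)) ∈ skSet (mkPhi N m cl) := by
  left
  refine Finset.mem_image.2 ⟨_, mkPhi_mem.2 (Or.inr (Or.inl rfl)), ?_⟩
  rw [skClause, bigClause, Finset.image_image]
  refine Finset.image_congr fun j hj => ?_
  simp only [Function.comp, skLit, skAtom_E (by simpa using hj)]; rfl

theorem in_H {N m : ℕ} {cl : ℕ → Clause} (h : GoodCl N m cl) {j : ℕ} (hj : j < m) {l : Lit}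
    (hl : l ∈ cl j) :
    ({sg false (eA N j .var), hlit (.var l.var) l} : FClause) ∈ skSet (mkPhi N m cl) := by
  left
  refine Finset.mem_image.2 ⟨_, mkPhi_mem.2 (Or.inr (Or.inr ⟨j, hj, l, hl, rfl⟩)), ?_⟩
  have := h.hvar j hj l hl
  rw [skClause, Finset.image_insert, Finset.image_singleton]
  congr 1
  · simp only [skLit, skAtom_E hj]; rfl
  · cases l with
    | pos k => simp only [Lit.negate, skLit, skAtom_U (k := k) this]; rfl
    | neg k => simp only [Lit.negate, skLit, skAtom_U (k := k) this]; rfl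

/-! ### The derivation -/

def t1 (N o i : ℕ) (k : ℕ) : FTerm := if k = i then dT N i else .var (o + k)
def tS (N : ℕ) (S : Finset ℕ) (k : ℕ) : FTerm := if k ∈ S then dT N k else .var (N + k)

theorem t1_size (N o i k : ℕ) : (t1 N o i k).symSize ≤ N + 1 := by
  unfold t1; split_ifs
  · rw [dT_size]
  · rw [FTerm.size_var]; omega

theorem tS_size (N : ℕ) (S : Finset ℕ) (k : ℕ) : (tS N S k).symSize ≤ N + 1 := by
  unfold tS; split_ifs
  · rw [dT_size]
  · rw [FTerm.size_var]; omega

theorem stepA {N m : ℕ} {cl : ℕ → Clause} (h : GoodCl N m cl) {j : ℕ} (hj : j < m) {l : Lit}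
    (hl : l ∈ cl j) (o : ℕ) (ho : N ≤ o) {C : FClause} (hC : ∀ x ∈ C.fvars, x < o)
    (hCs : ∀ σ : ℕ → FTerm, (∀ x < o, σ x = .var x) → C.subst σ = C) (hlC : dlit N l ∈ C)
    {s W : ℕ} (hd : Der (skSet (mkPhi N m cl)) C s) (hW1 : 2 * (N + 3) ^ 2 ≤ W)
    (hW2 : FClause.symSize ((C.erase (dlit N l)) ∪ {sg false (eA N j (t1 N o l.var))}) ≤ W) :
    Der (skSet (mkPhi N m cl)) ((C.erase (dlit N l)) ∪ {sg false (eA N j (t1 N o l.var))})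
      (s + W + W) := by
  have hi := h.hvar j hj l hl
  set i := l.var with hidef
  let σ : ℕ → FTerm := fun x => if x = o + i then dT N i else .var x
  have hσ : ∀ x < o, σ x = .var x := fun x hx => if_neg (by omega)
  have hσi : σ (o + i) = dT N i := if_pos rfl
  have hH : Der (skSet (mkPhi N m cl)) {sg false (eA N j .var), hlit (.var i) l} W := by
    refine Der.input (in_H h hj hl) (clause_size ?_ Finset.card_le_two hW1)
    intro x hx
    rcases Finset.mem_insert.1 hx with rfl | hx
    · exact eA_size fun k _ => by rw [FTerm.size_var]; omega
    · rw [Finset.mem_singleton.1 hx]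
      refine (sg_size _ _).trans ?_
      simp only [FAtom.symSize, List.map_cons, List.map_nil, List.sum_cons, List.sum_nil,
        FTerm.size_var]
      nlinarith
  have hren : FClause.subst (renameSub (o + ·)) {sg false (eA N j .var), hlit (.var i) l} =
      {sg false (eA N j fun k => .var (o + k)), hlit (.var (o + i)) l} := by
    rw [FClause.subst, Finset.image_insert, Finset.image_singleton, sg_subst, eA_subst, hlit,
      sg_subst]
    simp only [FTerm.subst_var, renameSub, FAtom.subst, List.map_cons, List.map_nil, hlit]
  refine Der.resolve hd hH o hC (dlit N l) (hlit (.var (o + i)) l) σ hlC ?_ ?_ ?_ ?_ hW2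
  · rw [hren]; simp
  · simp [dlit, hlit, sg_isPos]
  · simp only [dlit, hlit, sg_atom]
    apply isMGU_of
    · simp only [Unifies, FAtom.subst, List.map_cons, List.map_nil, FTerm.subst_var, hσi]
      rw [dT_subst_id _ fun x hx => hσ x (by omega)]
    · intro τ hτ x
      simp only [Unifies, FAtom.subst, List.map_cons, List.map_nil, FTerm.subst_var,
        FAtom.mk.injEq, List.cons.injEq, true_and, and_true] at hτ
      simp only [σ]
      split_ifs with hx
      · rw [hx, ← hτ]
      · rw [FTerm.subst_var]
  · rw [hren, hCs σ hσ, dlit_subst l fun x hx => hσ x (by omega)]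
    congr 1
    have e1 : (sg false (eA N j fun k => .var (o + k))).subst σ = sg false (eA N j (t1 N o i)) := by
      rw [sg_subst, eA_subst]
      congr 1
      refine eA_congr fun k _ => ?_
      rw [FTerm.subst_var]
      simp only [σ, t1]
      by_cases hk : k = i <;> simp [hk]
    have e2 : (hlit (.var (o + i)) l).subst σ = hlit (dT N i) l := by
      simp only [hlit, sg_subst, FAtom.subst, List.map_cons, List.map_nil, FTerm.subst_var, hσi]
    have hne : sg false (eA N j (t1 N o i)) ≠ hlit (dT N i) l := (hlit_ne_eA hi).symm
    rw [FClause.subst, Finset.image_insert, Finset.image_singleton, e1, e2,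
      Finset.erase_insert_of_ne hne]
    simp

/-- `X(S,R)` -/
noncomputable def clX (N j : ℕ) (S : Finset ℕ) (R : Clause) : FClause :=
  insert (sg false (eA N j (tS N S))) (R.image (dlit N))

theorem clX_fvars {N j : ℕ} {S : Finset ℕ} {R : Clause} :
    ∀ x ∈ (clX N j S R).fvars, x < 2 * N := by
  intro x hx
  obtain ⟨l, hl, t, ht, hx⟩ := FClause.mem_fvars.1 hx
  rcases Finset.mem_insert.1 hl with rfl | hl
  · rw [sg_atom] at ht
    simp only [eA, List.mem_singleton] at ht
    subst ht
    obtain ⟨k, hk, hx⟩ := mem_vars_eA.1 hx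
    unfold tS at hx
    split_ifs at hx
    · rw [mem_vars_dT] at hx; omega
    · rw [FTerm.mem_vars_var] at hx; omega
  · obtain ⟨l', _, rfl⟩ := Finset.mem_image.1 hl
    rw [dlit, sg_atom] at ht
    simp only [List.mem_singleton] at ht
    subst ht
    rw [mem_vars_dT] at hx; omega

theorem dlits_fvars {N : ℕ} {R : Clause} :
    ∀ x ∈ FClause.fvars (R.image (dlit N)), x < N := by
  intro x hx
  obtain ⟨l, hl, t, ht, hx⟩ := FClause.mem_fvars.1 hx
  obtain ⟨l', _, rfl⟩ := Finset.mem_image.1 hl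
  rw [dlit, sg_atom] at ht
  simp only [List.mem_singleton] at ht
  subst ht
  rwa [mem_vars_dT] at hx

theorem clX_subst {N j : ℕ} {S : Finset ℕ} {R : Clause} (σ : ℕ → FTerm)
    (hσ : ∀ x < 2 * N, σ x = .var x) : (clX N j S R).subst σ = clX N j S R := by
  have h0 : ∀ x < N, σ x = .var x := fun x hx => hσ x (by omega)
  have := dlits_subst R h0
  rw [FClause.subst] at this
  rw [clX, FClause.subst, Finset.image_insert, this, sg_subst, eA_subst]
  congr 2
  refine eA_congr fun k hk => ?_
  unfold tS
  split_ifs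
  · exact dT_subst_id _ h0
  · rw [FTerm.subst_var, hσ _ (by omega)]

theorem image_erase_dlit {N : ℕ} (R : Clause) (l : Lit) :
    (R.image (dlit N)).erase (dlit N l) = (R.erase l).image (dlit N) := by
  rw [Finset.image_erase]
  intro a b hab; exact dlit_inj hab

theorem dlits_card {N : ℕ} (R : Clause) : (R.image (dlit N)).card ≤ R.card := Finset.card_image_le

theorem X_size {N j c W : ℕ} {S : Finset ℕ} {R : Clause} (hR : R.card ≤ c)
    (hW : (c + 1) * (N + 3) ^ 2 ≤ W) : (clX N j S R).symSize ≤ W := by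
  refine clause_size ?_ ((Finset.card_insert_le _ _).trans
    (Nat.add_le_add_right ((dlits_card R).trans hR) 1)) hW
  intro x hx
  rcases Finset.mem_insert.1 hx with rfl | hx
  · exact eA_size fun k _ => tS_size _ _ _
  · obtain ⟨l, _, rfl⟩ := Finset.mem_image.1 hx
    exact dlit_size N l

theorem stepX {N m : ℕ} {cl : ℕ → Clause} (h : GoodCl N m cl) {j : ℕ} (hj : j < m) {l : Lit}
    (hl : l ∈ cl j) {S : Finset ℕ} {R : Clause} (hlR : l ∈ R) (hS : l.var ∉ S) (hR : R.card ≤ N)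
    {s W : ℕ} (hd : Der (skSet (mkPhi N m cl)) (clX N j S R) s) (hW : (N + 3) ^ 3 ≤ W) :
    Der (skSet (mkPhi N m cl)) (clX N j (insert l.var S) (R.erase l)) (s + 3 * W) := by
  have hi := h.hvar j hj l hl
  set i := l.var with hidef
  have hlX : dlit N l ∈ clX N j S R := Finset.mem_insert_of_mem (Finset.mem_image_of_mem _ hlR)
  have heq : ((clX N j S R).erase (dlit N l)) ∪ {sg false (eA N j (t1 N (2 * N) i))} =
      insert (sg false (eA N j (t1 N (2 * N) i))) (insert (sg false (eA N j (tS N S)))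
        ((R.erase l).image (dlit N))) := by
    rw [clX, Finset.erase_insert_of_ne, image_erase_dlit, Finset.union_comm,
      Finset.insert_eq (sg false (eA N j (t1 N (2 * N) i)))]
    exact (hlit_ne_eA hi).symm
  have hRe : (R.erase l).card ≤ N := (Finset.card_le_card (Finset.erase_subset _ _)).trans hR
  have hA := stepA h hj hl (2 * N) (by omega) clX_fvars clX_subst hlX hd (W := W)
    (by nlinarith [sq_nonneg (N + 3)]) (by
      rw [heq]
      refine clause_size (B := (N + 3) ^ 2) (c := N + 2) ?_ ?_ (by nlinarith [sq_nonneg (N + 3)])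
      · intro x hx
        rcases Finset.mem_insert.1 hx with rfl | hx
        · exact eA_size fun k _ => t1_size _ _ _ _
        rcases Finset.mem_insert.1 hx with rfl | hx
        · exact eA_size fun k _ => tS_size _ _ _
        · obtain ⟨l, _, rfl⟩ := Finset.mem_image.1 hx
          exact dlit_size N l
      · refine (Finset.card_insert_le _ _).trans (Nat.succ_le_succ ?_)
        refine (Finset.card_insert_le _ _).trans (Nat.succ_le_succ ?_)
        exact (dlits_card _).trans hRe)
  rw [heq] at hA
  have : s + 3 * W = s + W + W + W := by ring
  rw [this]
  refine Der.factor hA ?_ (X_size hRe (by nlinarith [sq_nonneg (N + 3)]))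
  let σ : ℕ → FTerm := fun x => if x = N + i then dT N i else
    if 2 * N ≤ x ∧ x < 3 * N ∧ x ≠ 2 * N + i then tS N S (x - 2 * N) else .var x
  have hσ0 : ∀ x < N, σ x = .var x := fun x hx => by
    simp only [σ]; rw [if_neg (by omega), if_neg (by omega)]
  have hσ1 : ∀ k < N, k ≠ i → σ (N + k) = .var (N + k) := fun k hk hki => by
    simp only [σ]; rw [if_neg (by omega), if_neg (by omega)]
  have hσ2 : σ (N + i) = dT N i := by simp only [σ, if_true]
  have hσ3 : ∀ k < N, k ≠ i → σ (2 * N + k) = tS N S k := fun k hk hki => by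
    simp only [σ]; rw [if_neg (by omega), if_pos (by omega)]; congr 1; omega
  have hts : ∀ k < N, (tS N S k).subst σ = tS N (insert i S) k := by
    intro k hk
    by_cases hki : k = i
    · subst hki
      rw [tS, if_neg hS, FTerm.subst_var, hσ2, tS, if_pos (Finset.mem_insert_self _ _)]
    · unfold tS
      by_cases hkS : k ∈ S
      · rw [if_pos hkS, if_pos (Finset.mem_insert_of_mem hkS), dT_subst_id _ hσ0]
      · rw [if_neg hkS, if_neg (by simp [hki, hkS]), FTerm.subst_var, hσ1 k hk hki]
  have ht1 : ∀ k < N, (t1 N (2 * N) i k).subst σ = tS N (insert i S) k := by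
    intro k hk
    unfold t1
    by_cases hki : k = i
    · rw [if_pos hki, dT_subst_id _ hσ0, tS, if_pos (by simp [hki]), hki]
    · rw [if_neg hki, FTerm.subst_var, hσ3 k hk hki]
      simp [tS, hki]
  refine ⟨sg false (eA N j (t1 N (2 * N) i)), sg false (eA N j (tS N S)), σ,
    Finset.mem_insert_self _ _, Finset.mem_insert_of_mem (Finset.mem_insert_self _ _), ?_,
    by simp [sg_isPos], ?_, ?_⟩
  · intro he
    have := (eA_eq.1 (sg_inj.1 he).2).2 i hi
    rw [t1, if_pos rfl, tS, if_neg hS] at this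
    simp [dT] at this
  · simp only [sg_atom]
    apply isMGU_of
    · unfold Unifies
      rw [eA_subst, eA_subst]
      exact eA_congr fun k hk => by rw [hts k hk, ht1 k hk]
    · intro τ hτ x
      unfold Unifies at hτ
      rw [eA_subst, eA_subst] at hτ
      have hτ := (eA_eq.1 hτ).2
      simp only [σ]
      split_ifs with h1 h2
      · have := hτ i hi
        rw [t1, if_pos rfl, tS, if_neg hS, FTerm.subst_var] at this
        rw [h1, this]
      · have := hτ (x - 2 * N) (by omega)
        rw [t1, if_neg (by omega), FTerm.subst_var, show 2 * N + (x - 2 * N) = x by omega] at this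
        exact this.symm
      · rw [FTerm.subst_var]
  · have hdl := dlits_subst (R.erase l) hσ0
    rw [FClause.subst] at hdl
    rw [FClause.subst, Finset.image_insert, Finset.image_insert, hdl, sg_subst, sg_subst, eA_subst,
      eA_subst, eA_congr ht1, eA_congr hts, Finset.insert_idem, clX]

theorem stepX_all {N m : ℕ} {cl : ℕ → Clause} (h : GoodCl N m cl) {j : ℕ} (hj : j < m)
    {W : ℕ} (hW : (N + 3) ^ 3 ≤ W) (R : Clause) (S : Finset ℕ) (s : ℕ) (hRc : R ⊆ cl j)
    (hS : ∀ l ∈ R, l.var ∉ S) (hR : R.card ≤ N)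
    (hd : Der (skSet (mkPhi N m cl)) (clX N j S R) s) :
    Der (skSet (mkPhi N m cl)) {sg false (eA N j (tS N (S ∪ R.image Lit.var)))}
      (s + R.card * (3 * W)) := by
  induction hn : R.card generalizing R S s with
  | zero =>
    have : R = ∅ := Finset.card_eq_zero.1 hn
    subst this
    simpa [clX] using hd
  | succ n ih =>
    obtain ⟨l, hl⟩ : R.Nonempty := Finset.card_pos.1 (by omega)
    have hc := Finset.card_erase_of_mem hl
    have := ih (R.erase l) (insert l.var S) (s + 3 * W) ((Finset.erase_subset _ _).trans hRc) ?_
      (by omega) (stepX h hj (hRc hl) hl (hS l hl) hR hd hW) (by omega)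
    · have e : insert l.var S ∪ (R.erase l).image Lit.var = S ∪ R.image Lit.var := by
        conv_rhs => rw [← Finset.insert_erase hl, Finset.image_insert]
        rw [Finset.insert_union, Finset.union_insert]
      rw [e] at this
      convert this using 1; ring
    · intro l' hl' hmem
      obtain ⟨hne, hl'⟩ := Finset.mem_erase.1 hl'
      rcases Finset.mem_insert.1 hmem with he | he
      · exact hne (h.hinj j hj _ (hRc hl') _ (hRc hl) he)
      · exact hS l' hl' he

theorem der_N {N m : ℕ} {cl : ℕ → Clause} (h : GoodCl N m cl) {j : ℕ} (hj : j < m)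
    {W : ℕ} (hW : (N + 3) ^ 3 ≤ W) :
    Der (skSet (mkPhi N m cl)) {sg false (eA N j (tS N ((cl j).image Lit.var)))}
      ((3 * N + 1) * W) := by
  have hcard : (cl j).card ≤ N := by
    have := Finset.card_le_card_of_injOn (s := cl j) (t := Finset.range N) Lit.var
      (fun l hl => by simpa using h.hvar j hj l hl) (fun l hl l' hl' he => h.hinj j hj l hl l' hl' he)
    simpa using this
  obtain ⟨l, hl⟩ := h.hne j hj
  have hc := Finset.card_erase_of_mem hl
  have hpos : 0 < (cl j).card := Finset.card_pos.2 ⟨l, hl⟩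
  have h0 : Der (skSet (mkPhi N m cl)) ((cl j).image (dlit N)) W := by
    refine Der.input (in_D h hj) (clause_size (B := (N + 3) ^ 2) ?_ ((dlits_card _).trans hcard)
      (by nlinarith [sq_nonneg (N + 3)]))
    intro x hx
    obtain ⟨l, _, rfl⟩ := Finset.mem_image.1 hx
    exact dlit_size N l
  have heq : ((cl j).image (dlit N)).erase (dlit N l) ∪ {sg false (eA N j (t1 N N l.var))} =
      clX N j {l.var} ((cl j).erase l) := by
    rw [image_erase_dlit, clX, Finset.union_comm, ← Finset.insert_eq]
    congr 2
    refine eA_congr fun k _ => ?_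
    simp only [t1, tS, Finset.mem_singleton]
    by_cases hk : k = l.var <;> simp [hk]
  have h1 := stepA h hj hl N le_rfl dlits_fvars (fun σ hσ => dlits_subst _ hσ)
    (Finset.mem_image_of_mem _ hl) h0 (W := W) (by nlinarith [sq_nonneg (N + 3)])
    (by rw [heq]; exact X_size (c := N) (by omega) (by nlinarith [sq_nonneg (N + 3)]))
  rw [heq] at h1
  have h2 := stepX_all h hj hW _ _ _ (Finset.erase_subset _ _) (by
    intro l' hl' hmem
    obtain ⟨hne, hl'⟩ := Finset.mem_erase.1 hl'
    exact hne (h.hinj j hj _ hl' _ hl (Finset.mem_singleton.1 hmem))) (by omega) h1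
  have e : {l.var} ∪ ((cl j).erase l).image Lit.var = (cl j).image Lit.var := by
    conv_rhs => rw [← Finset.insert_erase hl, Finset.image_insert]
    rw [Finset.insert_eq]
  rw [e] at h2
  obtain ⟨t, ht⟩ := h2
  refine ⟨t, ht.trans ?_⟩
  rw [hc]
  obtain ⟨c, hc'⟩ : ∃ c, (cl j).card = c + 1 := ⟨_, (Nat.succ_pred_eq_of_pos hpos).symm⟩
  rw [hc', Nat.add_sub_cancel]
  have : c + 1 ≤ N := by omega
  nlinarith [Nat.mul_le_mul_right W this]

noncomputable def clY (N m r : ℕ) : FClause :=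
  (Finset.Ico r m).image fun j => sg true (eA N j (dT N))

theorem clY_erase {N m r : ℕ} (_hr : r < m) :
    (clY N m r).erase (sg true (eA N r (dT N))) = clY N m (r + 1) := by
  have hinj : Function.Injective fun j => sg true (eA N j (dT N)) := by
    intro a b hab
    exact (eA_eq.1 (sg_inj.1 hab).2).1
  have := Finset.image_erase hinj (Finset.Ico r m) r
  rw [clY, ← this, clY]
  congr 1
  ext x; simp only [Finset.mem_erase, Finset.mem_Ico]; omega

theorem clY_size {N m r W : ℕ} (hW : m * (N + 3) ^ 2 ≤ W) : (clY N m r).symSize ≤ W := by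
  refine clause_size (B := (N + 3) ^ 2) (c := m) ?_ ?_ hW
  · intro x hx
    obtain ⟨j, _, rfl⟩ := Finset.mem_image.1 hx
    exact eA_size fun k _ => (dT_size N k).le
  · refine Finset.card_image_le.trans ?_
    simp

theorem eA_dT_fvars {N j x : ℕ} {b : Bool} {t : FTerm}
    (ht : t ∈ (sg b (eA N j (dT N))).atom.args) (hx : x ∈ t.vars) : x < N := by
  rw [sg_atom] at ht
  simp only [eA, List.mem_singleton] at ht
  subst ht
  obtain ⟨k, hk, hx⟩ := mem_vars_eA.1 hx
  rwa [mem_vars_dT] at hx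

theorem der_Y1 {N m : ℕ} {cl : ℕ → Clause} (h : GoodCl N m cl) {W : ℕ} (hW : (N + 3) ^ 3 ≤ W)
    (hW2 : m * (N + 3) ^ 2 ≤ W) :
    Der (skSet (mkPhi N m cl)) (clY N m 1) ((3 * N + 1) * W + W + W) := by
  have h0 := der_N h h.hm hW
  have e0 : eA N 0 (tS N ((cl 0).image Lit.var)) = eA N 0 (dT N) := by
    refine eA_congr fun k hk => ?_
    obtain ⟨l, hl, rfl⟩ := h.hfull k hk
    rw [tS, if_pos (Finset.mem_image_of_mem _ hl)]
  rw [e0] at h0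
  have hB : Der (skSet (mkPhi N m cl)) ((Finset.range m).image fun j => sg true (eA N j .var)) W := by
    refine Der.input in_Big (clause_size (B := (N + 3) ^ 2) (c := m) ?_ ?_ hW2)
    · intro x hx
      obtain ⟨j, _, rfl⟩ := Finset.mem_image.1 hx
      exact eA_size fun k _ => by rw [FTerm.size_var]; omega
    · exact Finset.card_image_le.trans (by simp)
  have hren : FClause.subst (renameSub (N + ·)) ((Finset.range m).image fun j => sg true (eA N j .var))
      = (Finset.range m).image fun j => sg true (eA N j fun k => .var (N + k)) := by
    rw [FClause.subst, Finset.image_image]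
    refine Finset.image_congr fun j _ => ?_
    simp only [Function.comp, sg_subst, eA_subst, FTerm.subst_var, renameSub]
  let σ : ℕ → FTerm := fun x => if N ≤ x ∧ x < 2 * N then dT N (x - N) else .var x
  have hσ0 : ∀ x < N, σ x = .var x := fun x hx => if_neg (by omega)
  have hσ1 : ∀ k < N, σ (N + k) = dT N k := fun k hk => by
    simp only [σ]; rw [if_pos (by omega)]; congr 1; omega
  have eK : (eA N 0 (dT N)).subst σ = eA N 0 (dT N) := by
    rw [eA_subst]; exact eA_congr fun k _ => dT_subst_id _ hσ0
  have eL : ∀ j, (eA N j fun k => .var (N + k)).subst σ = eA N j (dT N) := by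
    intro j
    rw [eA_subst]; exact eA_congr fun k hk => by rw [FTerm.subst_var, hσ1 k hk]
  refine Der.resolve h0 hB N ?_ (sg false (eA N 0 (dT N)))
    (sg true (eA N 0 fun k => .var (N + k))) σ (Finset.mem_singleton_self _) ?_ ?_ ?_ ?_
    (clY_size hW2)
  · intro x hx
    obtain ⟨l, hl, t, ht, hx⟩ := FClause.mem_fvars.1 hx
    rw [Finset.mem_singleton.1 hl] at ht
    exact eA_dT_fvars ht hx
  · rw [hren]
    exact Finset.mem_image.2 ⟨0, Finset.mem_range.2 h.hm, rfl⟩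
  · simp [sg_isPos]
  · simp only [sg_atom]
    apply isMGU_of
    · unfold Unifies; rw [eK, eL]
    · intro τ hτ x
      unfold Unifies at hτ
      rw [eA_subst, eA_subst] at hτ
      have hτ := (eA_eq.1 hτ).2
      simp only [σ]
      split_ifs with h1
      · have := hτ (x - N) (by omega)
        rw [FTerm.subst_var, show N + (x - N) = x by omega] at this
        exact this
      · rw [FTerm.subst_var]
  · have e1 : FClause.subst σ ((Finset.range m).image fun j => sg true (eA N j fun k => .var (N + k)))
        = clY N m 0 := by
      rw [FClause.subst, Finset.image_image, clY, Finset.range_eq_Ico]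
      refine Finset.image_congr fun j _ => ?_
      simp only [Function.comp, sg_subst, eL]
    rw [hren, e1, sg_subst, sg_subst, eL, clY_erase h.hm]
    simp [FClause.subst, sg_subst]

theorem der_Ystep {N m : ℕ} {cl : ℕ → Clause} (h : GoodCl N m cl) {W s r : ℕ} (hr : r < m)
    (hW : (N + 3) ^ 3 ≤ W) (hW2 : m * (N + 3) ^ 2 ≤ W)
    (hd : Der (skSet (mkPhi N m cl)) (clY N m r) s) :
    Der (skSet (mkPhi N m cl)) (clY N m (r + 1)) (s + (3 * N + 1) * W + W) := by
  have h0 := der_N h hr hW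
  set S := (cl r).image Lit.var with hS
  obtain ⟨k0, hk0, hk0N⟩ : ∃ k0 ∈ S, k0 < N := by
    obtain ⟨l, hl⟩ := h.hne r hr
    exact ⟨l.var, Finset.mem_image_of_mem _ hl, h.hvar r hr l hl⟩
  let t' : ℕ → FTerm := fun k => if k ∈ S then
    .app (N + k + 2) ((List.range N).map fun x => .var (N + x)) else .var (N + (N + k))
  have hren : FClause.subst (renameSub (N + ·)) {sg false (eA N r (tS N S))} =
      {sg false (eA N r t')} := by
    rw [FClause.subst, Finset.image_singleton, sg_subst, eA_subst]
    congr 2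
    refine eA_congr fun k _ => ?_
    simp only [tS, t']
    split_ifs
    · rw [dT_subst]; rfl
    · rw [FTerm.subst_var]; rfl
  let σ : ℕ → FTerm := fun x => if N ≤ x ∧ x < 2 * N then .var (x - N) else
    if 2 * N ≤ x ∧ x < 3 * N ∧ x - 2 * N ∉ S then dT N (x - 2 * N) else .var x
  have hσ0 : ∀ x < N, σ x = .var x := fun x hx => by
    simp only [σ]; rw [if_neg (by omega), if_neg (by omega)]
  have hσ1 : ∀ k < N, σ (N + k) = .var k := fun k hk => by
    simp only [σ]; rw [if_pos (by omega)]; congr 1; omega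
  have hσ2 : ∀ k < N, k ∉ S → σ (N + (N + k)) = dT N k := fun k hk hkS => by
    have e : N + (N + k) - 2 * N = k := by omega
    simp only [σ]
    rw [if_neg (by omega), if_pos ⟨by omega, by omega, by rwa [e]⟩, e]
  have eK : ∀ j, (eA N j (dT N)).subst σ = eA N j (dT N) := by
    intro j
    rw [eA_subst]; exact eA_congr fun k _ => dT_subst_id _ hσ0
  have eL : (eA N r t').subst σ = eA N r (dT N) := by
    rw [eA_subst]
    refine eA_congr fun k hk => ?_
    simp only [t']
    split_ifs with hkS
    · rw [FTerm.subst_app, List.map_map, dT]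
      congr 1
      refine List.map_congr_left fun x hx => ?_
      rw [Function.comp, FTerm.subst_var, hσ1 x (List.mem_range.1 hx)]
    · rw [FTerm.subst_var, hσ2 k hk hkS]
  refine Der.resolve hd h0 N ?_ (sg true (eA N r (dT N))) (sg false (eA N r t')) σ
    (Finset.mem_image.2 ⟨r, by simp [hr], rfl⟩) ?_ ?_ ?_ ?_ (clY_size hW2)
  · intro x hx
    obtain ⟨l, hl, t, ht, hx⟩ := FClause.mem_fvars.1 hx
    obtain ⟨j, _, rfl⟩ := Finset.mem_image.1 hl
    exact eA_dT_fvars ht hx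
  · rw [hren]
    exact Finset.mem_singleton_self _
  · simp [sg_isPos]
  · simp only [sg_atom]
    apply isMGU_of
    · unfold Unifies; rw [eK, eL]
    · intro τ hτ x
      unfold Unifies at hτ
      rw [eA_subst, eA_subst] at hτ
      have hτ := (eA_eq.1 hτ).2
      have hτ0 := hτ k0 hk0N
      simp only [t', if_pos hk0] at hτ0
      rw [dT_subst, FTerm.subst_app, List.map_map] at hτ0
      simp only [FTerm.app.injEq, true_and, List.map_inj_left, List.mem_range, Function.comp,
        FTerm.subst_var] at hτ0
      simp only [σ]
      split_ifs with h1 h2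
      · rw [FTerm.subst_var, hτ0 (x - N) (by omega)]
        congr 1; omega
      · have := hτ (x - 2 * N) (by omega)
        simp only [t', if_neg h2.2.2, FTerm.subst_var] at this
        rw [this]
        congr 1; omega
      · rw [FTerm.subst_var]
  · have e1 : FClause.subst σ (clY N m r) = clY N m r := by
      rw [FClause.subst, clY, Finset.image_image]
      refine Finset.image_congr fun j _ => ?_
      simp only [Function.comp, sg_subst, eK]
    rw [hren, e1, sg_subst, eK, clY_erase hr]
    simp [FClause.subst]

theorem sk_upper {N m : ℕ} {cl : ℕ → Clause} (h : GoodCl N m cl) {W : ℕ}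
    (hW : (N + 3) ^ 3 ≤ W) (hW2 : m * (N + 3) ^ 2 ≤ W) :
    ∃ t : R1Tree (skSet (mkPhi N m cl)) ∅, t.size ≤ (m + 1) * ((3 * N + 3) * W) := by
  have key : ∀ r, r < m → Der (skSet (mkPhi N m cl)) (clY N m (r + 1))
      ((r + 1) * ((3 * N + 3) * W)) := by
    intro r
    induction r with
    | zero =>
      intro _
      obtain ⟨t, ht⟩ := der_Y1 h hW hW2
      exact ⟨t, ht.trans (by nlinarith)⟩
    | succ r ih =>
      intro hr
      obtain ⟨t, ht⟩ := der_Ystep h hr hW hW2 (ih (by omega))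
      exact ⟨t, ht.trans (by nlinarith)⟩
  obtain ⟨t, ht⟩ := key (m - 1) (by have := h.hm; omega)
  have e : clY N m (m - 1 + 1) = ∅ := by
    have := h.hm
    rw [clY, Finset.Ico_eq_empty (by omega), Finset.image_empty]
  rw [e] at t
  have hd : Der (skSet (mkPhi N m cl)) ∅ ((m - 1 + 1) * ((3 * N + 3) * W)) := by
    rw [← e]; exact key (m - 1) (by have := h.hm; omega)
  obtain ⟨t, ht⟩ := hd
  exact ⟨t, ht.trans (Nat.mul_le_mul_right _ (by omega))⟩


/-! ## Conclusion -/

theorem poly_eval_mono (q : Polynomial ℕ) {a b : ℕ} (h : a ≤ b) : q.eval a ≤ q.eval b := by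
  rw [Polynomial.eval_eq_sum_range, Polynomial.eval_eq_sum_range]
  exact Finset.sum_le_sum fun i _ => Nat.mul_le_mul_left _ (Nat.pow_le_pow_left h i)

theorem poly_eval_le (q : Polynomial ℕ) {a : ℕ} (h : 0 < a) :
    q.eval a ≤ q.eval 1 * a ^ q.natDegree := by
  rw [Polynomial.eval_eq_sum_range, Polynomial.eval_eq_sum_range, Finset.sum_mul]
  refine Finset.sum_le_sum fun i hi => ?_
  rw [one_pow, mul_one]
  exact Nat.mul_le_mul_left _ (Nat.pow_le_pow_right h (by simp at hi; omega))

theorem exp_beats (A k : ℕ) (h : ∀ g : ℕ, 0 < g → 36 ^ (3 * g) ≤ A * g ^ k * 35 ^ (3 * g)) :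
    False := by
  have hr : (1 : ℝ) < (36 / 35) ^ 3 := by norm_num
  have ht := (tendsto_pow_const_div_const_pow_of_one_lt k hr).const_mul (A : ℝ)
  rw [mul_zero] at ht
  have h1 := ht.eventually (gt_mem_nhds (show (0 : ℝ) < 1 by norm_num))
  obtain ⟨g, hg, hlt⟩ := ((Filter.eventually_gt_atTop 0).and h1).exists
  have h2 : ((36 : ℝ)) ^ (3 * g) ≤ A * (g : ℝ) ^ k * 35 ^ (3 * g) := by exact_mod_cast h g hg
  have h3 : ((36 / 35 : ℝ) ^ 3) ^ g = 36 ^ (3 * g) / 35 ^ (3 * g) := by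
    rw [← pow_mul, div_pow]
  rw [h3, ← mul_div_assoc, div_div_eq_mul_div, div_lt_one (by positivity)] at hlt
  linarith

theorem sk_upper_php {g n : ℕ} (hg : 0 < g) (hn : n + 1 = 6 * g) :
    ∃ t : R1Tree (skSet (mkPhi ((n + 1) * n) (phpList n).length (phpCl n))) ∅,
      t.size ≤ 3 * 382 ^ 5 * g ^ 15 := by
  have hlen := phpList_length n
  have hgood := php_good (n := n) (by omega)
  set m := (phpList n).length
  set N := (n + 1) * n
  have hz : m + N + 3 ≤ 382 * g ^ 3 := by
    have h1 : (n + 2) ^ 3 ≤ (7 * g) ^ 3 := Nat.pow_le_pow_left (by omega) 3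
    have h2 : N ≤ (6 * g) * (6 * g) := Nat.mul_le_mul (by omega) (by omega)
    have h3 : g ^ 2 ≤ g ^ 3 := Nat.pow_le_pow_right hg (by norm_num)
    have h4 : 1 ≤ g ^ 3 := Nat.one_le_pow _ _ hg
    nlinarith
  set z := m + N + 3 with hzdef
  obtain ⟨t, ht⟩ := sk_upper hgood (W := z ^ 3) (Nat.pow_le_pow_left (by omega) 3) (by
    calc m * (N + 3) ^ 2 ≤ z * z ^ 2 :=
          Nat.mul_le_mul (by omega) (Nat.pow_le_pow_left (by omega) 2)
      _ = z ^ 3 := by ring)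
  refine ⟨t, ht.trans ?_⟩
  calc (m + 1) * ((3 * N + 3) * z ^ 3) ≤ z * ((3 * z) * z ^ 3) := by
        refine Nat.mul_le_mul (by omega) (Nat.mul_le_mul_right _ (by omega))
    _ = 3 * z ^ 5 := by ring
    _ ≤ 3 * (382 * g ^ 3) ^ 5 := Nat.mul_le_mul_left _ (Nat.pow_le_pow_left hz 5)
    _ = 3 * 382 ^ 5 * g ^ 15 := by rw [mul_pow, ← pow_mul, mul_assoc]

/-- R1 + EPR cannot polynomially simulate tree R1 + Sk. -/
theorem r1_epr_cannot_psimulate_tree_r1_sk :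
    ¬ ∃ q : Polynomial ℕ, ∀ Φ : PCNF, Φ.WF → Φ.Closed → ¬ Φ.IsTrue →
        ∀ t : R1Tree (skSet Φ) ∅, ∃ ρ : List FClause,
          R1Refutation (eprSet Φ) ρ ∧ r1Size ρ ≤ q.eval t.size := by
  rintro ⟨q, hq⟩
  obtain ⟨c, hc⟩ : ∃ c, c = 3 * 382 ^ 5 := ⟨_, rfl⟩
  have hc0 : 0 < c := by rw [hc]; positivity
  apply exp_beats (q.eval 1 * c ^ q.natDegree + 1) (15 * q.natDegree)
  intro g hg
  obtain ⟨n, hn⟩ : ∃ n, n + 1 = 6 * g := ⟨6 * g - 1, by omega⟩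
  have hgood := php_good (n := n) (by omega)
  obtain ⟨t, ht⟩ := sk_upper_php hg hn
  obtain ⟨ρ, hρ, hs⟩ := hq _ (mkPhi_wf hgood.hN) (mkPhi_closed hgood) (mkPhi_false hgood) t
  refine (epr_lower hg hn hρ).trans (Nat.mul_le_mul_right _ ?_)
  rw [← hc] at ht
  have h1 := (hs.trans (poly_eval_mono q ht)).trans (poly_eval_le q (by positivity))
  rw [mul_pow, ← pow_mul] at h1
  have h2 : 1 ≤ g ^ (15 * q.natDegree) := Nat.one_le_pow _ _ hg
  nlinarith
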